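/- arXiv:2507.04328 — 5 statements merged into one kernel-verified Lean document; each statement's English description precedes it below -/
import Mathlib

section
/- Let 0 < β < α < 1, assume f : ℝ → ℝ is non-decreasing, and let g ∈ C^{0,β}(∂Ω). Let u : Ω̄ → ℝ be a continuous viscosity solution of L[u] = f(u) on Ω with u = g on ∂Ω. Then for every x ∈ Ω̄ and every x₀ ∈ ∂Ω, |u(x) − u(x₀)| ≤ C|x − x₀|^β, where C = max{ [g]_{β,∂Ω} , diam(Ω)^{α−β} · max(f(‖g‖_∞), 0) / (1 − Ψ(r⋆)) , diam(Ω)^{α−β} · max(−f(−‖g‖_∞), 0) / (1 − Ψ(r⋆)) } and Ψ(r⋆) = (r⋆^β − 1)/(r⋆ − 1)^α. Consequently u ∈ C^{0,β}(Ω̄). -/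
open Set Metric

/-- The fractional sup-operator `L⁺[u](x)`. -/
noncomputable def Lplus {n : ℕ} (Ω : Set (EuclideanSpace ℝ (Fin n))) (α : ℝ)
    (u : EuclideanSpace ℝ (Fin n) → ℝ) (x : EuclideanSpace ℝ (Fin n)) : ℝ :=
  sSup ((fun y => (u y - u x) / ‖y - x‖ ^ α) '' (closure Ω \ {x}))

/-- The fractional inf-operator `L⁻[u](x)`. -/
noncomputable def Lminus {n : ℕ} (Ω : Set (EuclideanSpace ℝ (Fin n))) (α : ℝ)
    (u : EuclideanSpace ℝ (Fin n) → ℝ) (x : EuclideanSpace ℝ (Fin n)) : ℝ :=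
  sInf ((fun y => (u y - u x) / ‖y - x‖ ^ α) '' (closure Ω \ {x}))

/-- The fractional infinity Laplacian `L[u](x) = L⁺[u](x) + L⁻[u](x)`. -/
noncomputable def Lop {n : ℕ} (Ω : Set (EuclideanSpace ℝ (Fin n))) (α : ℝ)
    (u : EuclideanSpace ℝ (Fin n) → ℝ) (x : EuclideanSpace ℝ (Fin n)) : ℝ :=
  Lplus Ω α u x + Lminus Ω α u x

/-- `u` is a viscosity subsolution of `L[u] = f(u)` on `U ⊆ Ω`. -/
def IsViscositySubsolution {n : ℕ} (Ω U : Set (EuclideanSpace ℝ (Fin n))) (α : ℝ)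
    (f : ℝ → ℝ) (u : EuclideanSpace ℝ (Fin n) → ℝ) : Prop :=
  UpperSemicontinuousOn u (closure Ω) ∧
  ∀ φ : EuclideanSpace ℝ (Fin n) → ℝ,
    ContDiffOn ℝ 1 φ U → ContinuousOn φ (closure Ω) →
    (∀ x ∈ closure Ω, u x ≤ φ x) →
    ∀ x₀ ∈ U, u x₀ = φ x₀ → -Lop Ω α φ x₀ + f (φ x₀) ≤ 0

/-- `u` is a viscosity supersolution of `L[u] = f(u)` on `U ⊆ Ω`. -/
def IsViscositySupersolution {n : ℕ} (Ω U : Set (EuclideanSpace ℝ (Fin n))) (α : ℝ)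
    (f : ℝ → ℝ) (u : EuclideanSpace ℝ (Fin n) → ℝ) : Prop :=
  LowerSemicontinuousOn u (closure Ω) ∧
  ∀ φ : EuclideanSpace ℝ (Fin n) → ℝ,
    ContDiffOn ℝ 1 φ U → ContinuousOn φ (closure Ω) →
    (∀ x ∈ closure Ω, φ x ≤ u x) →
    ∀ x₀ ∈ U, u x₀ = φ x₀ → 0 ≤ -Lop Ω α φ x₀ + f (φ x₀)

/-- `u` is a strict viscosity supersolution of `L[u] = f(u)` on `U ⊆ Ω`. -/
def IsStrictViscositySupersolution {n : ℕ} (Ω U : Set (EuclideanSpace ℝ (Fin n))) (α : ℝ)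
    (f : ℝ → ℝ) (u : EuclideanSpace ℝ (Fin n) → ℝ) : Prop :=
  LowerSemicontinuousOn u (closure Ω) ∧
  ∀ φ : EuclideanSpace ℝ (Fin n) → ℝ,
    ContDiffOn ℝ 1 φ U → ContinuousOn φ (closure Ω) →
    (∀ x ∈ closure Ω, φ x ≤ u x) →
    ∀ x₀ ∈ U, u x₀ = φ x₀ → 0 < -Lop Ω α φ x₀ + f (φ x₀)

/-- The defining function of the critical ratio is convex along the curves `l ↦ r ^ l`. -/
theorem critical_fun_rpow_le {α β r l : ℝ} (hβ0 : 0 < β) (hβα : β < α) (hr : 0 < r)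
    (hl0 : 0 ≤ l) (hl1 : l ≤ 1) :
    (α - β) * (r ^ l) ^ β + β * (r ^ l) ^ (β - 1) - α ≤
      l * ((α - β) * r ^ β + β * r ^ (β - 1) - α) := by
  have key : ∀ p : ℝ, (r ^ l) ^ p ≤ l * r ^ p + (1 - l) := by
    intro p
    have h := Real.geom_mean_le_arith_mean2_weighted hl0 (sub_nonneg.2 hl1)
      (Real.rpow_nonneg hr.le p) zero_le_one (by ring)
    rw [Real.one_rpow, mul_one, mul_one, ← Real.rpow_mul hr.le] at h
    rwa [← Real.rpow_mul hr.le, mul_comm l p]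
  nlinarith [mul_le_mul_of_nonneg_left (key β) (sub_nonneg.2 hβα.le),
    mul_le_mul_of_nonneg_left (key (β - 1)) hβ0.le]

theorem critical_fun_sign {α β r s : ℝ} (hβ0 : 0 < β) (hβα : β < α) (hr : 1 < r) (hrs : r ≤ s) :
    ((α - β) * s ^ β + β * s ^ (β - 1) - α ≤ 0 → (α - β) * r ^ β + β * r ^ (β - 1) - α ≤ 0) ∧
    (0 ≤ (α - β) * r ^ β + β * r ^ (β - 1) - α → 0 ≤ (α - β) * s ^ β + β * s ^ (β - 1) - α) := by
  have hs : 1 < s := hr.trans_le hrs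
  have hls : 0 < Real.log s := Real.log_pos hs
  have hlr : 0 < Real.log r := Real.log_pos hr
  have hl0 : 0 < Real.log r / Real.log s := div_pos hlr hls
  have hl1 : Real.log r / Real.log s ≤ 1 :=
    (div_le_one hls).2 (Real.log_le_log (by linarith) hrs)
  have h := critical_fun_rpow_le (r := s) hβ0 hβα (by linarith) hl0.le hl1
  have e : s ^ (Real.log r / Real.log s) = r := by
    rw [Real.rpow_def_of_pos (by linarith), mul_div_cancel₀ _ hls.ne', Real.exp_log (by linarith)]
  rw [e] at h
  refine ⟨fun h1 => h.trans (mul_nonpos_of_nonneg_of_nonpos hl0.le h1), fun h1 => ?_⟩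
  exact nonneg_of_mul_nonneg_right (h1.trans h) hl0

theorem hasDerivAt_ratio {α β r : ℝ} (hr : 1 < r) :
    HasDerivAt (fun r : ℝ => (r ^ β - 1) / (r - 1) ^ α)
      (-((r - 1) ^ (α - 1) * ((α - β) * r ^ β + β * r ^ (β - 1) - α) / ((r - 1) ^ α) ^ 2)) r := by
  have h0 : 0 < r := by linarith
  have h1 : 0 < r - 1 := by linarith
  have hn := (Real.hasDerivAt_rpow_const (p := β) (Or.inl h0.ne')).sub_const 1
  have hd := ((hasDerivAt_id r).sub_const 1).rpow_const (p := α) (Or.inl h1.ne')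
  have h := hn.div hd (Real.rpow_pos_of_pos h1 α).ne'
  refine h.congr_deriv ?_
  have e1 : (r - 1) ^ α = (r - 1) ^ (α - 1) * (r - 1) := by
    rw [← Real.rpow_add_one h1.ne', sub_add_cancel]
  have e2 : r ^ β = r ^ (β - 1) * r := by
    rw [← Real.rpow_add_one h0.ne', sub_add_cancel]
  simp only [id]
  rw [neg_div', e1, e2]
  congr 1
  ring

theorem ratio_le_critical {α β s r : ℝ} (hβ0 : 0 < β) (hβα : β < α) (hs : 1 < s)
    (heq : (α - β) * s ^ β + β * s ^ (β - 1) - α = 0) (hr : 1 < r) :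
    (r ^ β - 1) / (r - 1) ^ α ≤ (s ^ β - 1) / (s - 1) ^ α := by
  rcases le_total r s with h | h
  · have hm : MonotoneOn (fun r : ℝ => (r ^ β - 1) / (r - 1) ^ α) (Ioc 1 s) := by
      refine monotoneOn_of_deriv_nonneg (convex_Ioc 1 s)
        (fun x hx => (hasDerivAt_ratio hx.1).continuousAt.continuousWithinAt) ?_ ?_ <;>
        rw [interior_Ioc]
      · exact fun x hx => (hasDerivAt_ratio hx.1).differentiableAt.differentiableWithinAt
      · intro x hx
        rw [(hasDerivAt_ratio hx.1).deriv, neg_nonneg]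
        refine div_nonpos_of_nonpos_of_nonneg (mul_nonpos_of_nonneg_of_nonpos
          (Real.rpow_nonneg (by linarith [hx.1]) _) ?_) (sq_nonneg _)
        exact (critical_fun_sign hβ0 hβα hx.1 hx.2.le).1 heq.le
    exact hm ⟨hr, h⟩ ⟨hs, le_rfl⟩ h
  · have hm : AntitoneOn (fun r : ℝ => (r ^ β - 1) / (r - 1) ^ α) (Ici s) := by
      refine antitoneOn_of_deriv_nonpos (convex_Ici s)
        (fun x hx => (hasDerivAt_ratio (hs.trans_le hx)).continuousAt.continuousWithinAt) ?_ ?_ <;>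
        rw [interior_Ici]
      · exact fun x hx =>
          (hasDerivAt_ratio (hs.trans hx)).differentiableAt.differentiableWithinAt
      · intro x hx
        rw [(hasDerivAt_ratio (hs.trans hx)).deriv, neg_nonpos]
        refine div_nonneg (mul_nonneg
          (Real.rpow_nonneg (by linarith [hs, mem_Ioi.1 hx]) _) ?_) (sq_nonneg _)
        exact (critical_fun_sign hβ0 hβα hs (mem_Ioi.1 hx).le).2 heq.ge
    exact hm self_mem_Ici h h

theorem ratio_nonneg {α β r : ℝ} (hβ0 : 0 < β) (hr : 1 < r) : 0 ≤ (r ^ β - 1) / (r - 1) ^ α :=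
  div_nonneg (sub_nonneg.2 (Real.one_le_rpow hr.le hβ0.le)) (Real.rpow_nonneg (by linarith) _)

theorem ratio_lt_one {α β r : ℝ} (hβ0 : 0 < β) (hβα : β < α) (hα1 : α < 1) (hr : 1 < r) :
    (r ^ β - 1) / (r - 1) ^ α < 1 := by
  have h1 : 0 < r - 1 := by linarith
  rw [div_lt_one (Real.rpow_pos_of_pos h1 α)]
  have h := Real.rpow_add_le_add_rpow h1.le zero_le_one (hβ0.trans hβα).le hα1.le
  rw [sub_add_cancel, Real.one_rpow] at h
  linarith [Real.rpow_lt_rpow_of_exponent_lt hr hβα]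

theorem rpow_sub_rpow_le_of_ratio_le {α β Q d ρ P : ℝ} (hβ0 : 0 < β) (hα0 : 0 < α) (hQ0 : 0 ≤ Q)
    (hQ : ∀ r : ℝ, 1 < r → (r ^ β - 1) / (r - 1) ^ α ≤ Q)
    (hd : 0 < d) (hρ : 0 ≤ ρ) (hP : 0 ≤ P) (hρP : ρ - d ≤ P) :
    ρ ^ β - d ^ β ≤ Q * d ^ (β - α) * P ^ α := by
  rcases le_or_gt ρ d with h | h
  · have := Real.rpow_le_rpow hρ h hβ0.le
    have : 0 ≤ Q * d ^ (β - α) * P ^ α := by positivity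
    linarith
  · have hr : 1 < ρ / d := (one_lt_div hd).2 h
    have h1 := hQ _ hr
    rw [div_le_iff₀ (Real.rpow_pos_of_pos (by linarith) α)] at h1
    have e1 : (ρ / d) ^ β = ρ ^ β / d ^ β := Real.div_rpow hρ hd.le β
    have e2 : (ρ / d - 1) ^ α = (ρ - d) ^ α / d ^ α := by
      rw [← Real.div_rpow (by linarith) hd.le, sub_div, div_self hd.ne']
    rw [e1, e2] at h1
    have hdβ := Real.rpow_pos_of_pos hd β
    have h2 := mul_le_mul_of_nonneg_right h1 hdβ.le
    have h3 : ρ ^ β - d ^ β ≤ Q * d ^ (β - α) * (ρ - d) ^ α := by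
      rw [Real.rpow_sub hd]
      calc ρ ^ β - d ^ β = (ρ ^ β / d ^ β - 1) * d ^ β := by field_simp
        _ ≤ _ := h2
        _ = _ := by ring
    refine h3.trans (mul_le_mul_of_nonneg_left (Real.rpow_le_rpow (by linarith) hρP hα0.le) ?_)
    positivity

theorem rpow_sub_rpow_le {α β d ρ P : ℝ} (hβ0 : 0 < β) (hβα : β < α) (hα1 : α < 1)
    (hd : 0 < d) (hρ : 0 ≤ ρ) (hP : 0 ≤ P) (hρP : d - ρ ≤ P) :
    d ^ β - ρ ^ β ≤ d ^ (β - α) * P ^ α := by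
  have hα0 := hβ0.trans hβα
  rcases le_or_gt d ρ with h | h
  · have := Real.rpow_le_rpow hd.le h hβ0.le
    have : 0 ≤ d ^ (β - α) * P ^ α := by positivity
    linarith
  · have hs1 : ρ / d ≤ 1 := (div_le_one hd).2 h.le
    have hs0 : 0 ≤ ρ / d := by positivity
    have h1 : ρ / d ≤ (ρ / d) ^ β := by
      rcases hs0.eq_or_lt with h0 | h0
      · rw [← h0, Real.zero_rpow hβ0.ne']
      · simpa using Real.rpow_le_rpow_of_exponent_ge h0 hs1 (hβα.trans hα1).le
    have h2 : 1 - ρ / d ≤ (1 - ρ / d) ^ α := by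
      have h0 : 0 < 1 - ρ / d := sub_pos.2 ((div_lt_one hd).2 h)
      simpa using Real.rpow_le_rpow_of_exponent_ge h0 (by linarith) hα1.le
    have e1 : (ρ / d) ^ β = ρ ^ β / d ^ β := Real.div_rpow hρ hd.le β
    have e2 : (1 - ρ / d) ^ α = (d - ρ) ^ α / d ^ α := by
      rw [← Real.div_rpow (by linarith) hd.le, sub_div, div_self hd.ne']
    rw [e1] at h1
    rw [e2] at h2
    have hdβ := Real.rpow_pos_of_pos hd β
    have h3 : d ^ β - ρ ^ β ≤ d ^ (β - α) * (d - ρ) ^ α := by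
      rw [Real.rpow_sub hd]
      calc d ^ β - ρ ^ β = (1 - ρ ^ β / d ^ β) * d ^ β := by field_simp
        _ ≤ (d - ρ) ^ α / d ^ α * d ^ β := mul_le_mul_of_nonneg_right (by linarith) hdβ.le
        _ = _ := by ring
    refine h3.trans (mul_le_mul_of_nonneg_left (Real.rpow_le_rpow (by linarith) hρP hα0.le) ?_)
    positivity

/-- Increments of a concave power decrease under translation. -/
theorem add_rpow_sub_add_rpow_le {a b e p : ℝ} (ha : 0 ≤ a) (hab : a ≤ b) (he : 0 ≤ e)
    (hp0 : 0 ≤ p) (hp1 : p ≤ 1) : (b + e) ^ p - (a + e) ^ p ≤ b ^ p - a ^ p := by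
  rcases hab.eq_or_lt with rfl | hlt
  · simp
  have hD : 0 < b + e - a := by linarith
  have hs0 : 0 ≤ (b - a) / (b + e - a) := div_nonneg (by linarith) hD.le
  have ht0 : 0 ≤ e / (b + e - a) := by positivity
  have hst : e / (b + e - a) + (b - a) / (b + e - a) = 1 := by field_simp; ring
  have hc := Real.concaveOn_rpow hp0 hp1
  have h1 := hc.2 (mem_Ici.2 ha) (mem_Ici.2 (by linarith : 0 ≤ b + e)) ht0 hs0 hst
  have h2 := hc.2 (mem_Ici.2 ha) (mem_Ici.2 (by linarith : 0 ≤ b + e)) hs0 ht0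
    (by rw [add_comm]; exact hst)
  simp only [smul_eq_mul] at h1 h2
  have e1 : e / (b + e - a) * a + (b - a) / (b + e - a) * (b + e) = b := by field_simp; ring
  have e2 : (b - a) / (b + e - a) * a + e / (b + e - a) * (b + e) = a + e := by field_simp; ring
  rw [e1] at h1
  rw [e2] at h2
  have e3 := congrArg (· * (a ^ p + (b + e) ^ p)) hst
  nlinarith

theorem sq_rpow_half {t β : ℝ} (ht : 0 ≤ t) : (t ^ 2) ^ (β / 2) = t ^ β := by
  rw [← Real.rpow_natCast, ← Real.rpow_mul ht]
  congr 1
  push_cast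
  ring

theorem sq_add_sq_rpow_sub_le {a b e β : ℝ} (ha : 0 ≤ a) (hab : a ≤ b)
    (hβ0 : 0 < β) (hβ1 : β < 1) :
    (b ^ 2 + e ^ 2) ^ (β / 2) - (a ^ 2 + e ^ 2) ^ (β / 2) ≤ b ^ β - a ^ β := by
  rw [← sq_rpow_half (t := b) (by linarith), ← sq_rpow_half (t := a) ha]
  exact add_rpow_sub_add_rpow_le (sq_nonneg _) (by gcongr) (sq_nonneg _) (by linarith)
    (by linarith)

theorem sq_add_sq_rpow_mono {a b e β : ℝ} (ha : 0 ≤ a) (hab : a ≤ b) (hβ0 : 0 < β) :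
    (a ^ 2 + e ^ 2) ^ (β / 2) ≤ (b ^ 2 + e ^ 2) ^ (β / 2) := by
  gcongr

theorem Lop_neg {n : ℕ} (Ω : Set (EuclideanSpace ℝ (Fin n))) (α : ℝ)
    (u : EuclideanSpace ℝ (Fin n) → ℝ) (x : EuclideanSpace ℝ (Fin n)) :
    Lop Ω α (fun y => -u y) x = -Lop Ω α u x := by
  have h : (fun y => (-u y - -u x) / ‖y - x‖ ^ α) '' (closure Ω \ {x}) =
      -((fun y => (u y - u x) / ‖y - x‖ ^ α) '' (closure Ω \ {x})) := by
    rw [← Set.image_neg_eq_neg, Set.image_image]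
    refine Set.image_congr fun y _ => ?_
    ring
  simp only [Lop, Lplus, Lminus, h, Real.sInf_neg, Real.sSup_neg]
  ring

theorem IsViscositySupersolution.neg {n : ℕ} {Ω U : Set (EuclideanSpace ℝ (Fin n))} {α : ℝ}
    {f : ℝ → ℝ} {u : EuclideanSpace ℝ (Fin n) → ℝ} (h : IsViscositySupersolution Ω U α f u) :
    IsViscositySubsolution Ω U α (fun t => -f (-t)) (fun x => -u x) := by
  refine ⟨h.1.neg, fun φ hφ hφc hle x₀ hx₀ heq => ?_⟩
  have h1 := h.2 (fun y => -φ y) hφ.neg hφc.neg (fun x hx => by linarith [hle x hx]) x₀ hx₀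
    (by linarith)
  rw [Lop_neg] at h1
  linarith

/-- The operator applied to a regularised radial power barrier. -/
theorem Lop_barrier_le {n : ℕ} {Ω : Set (EuclideanSpace ℝ (Fin n))} {α β Q C c ε : ℝ}
    (hβ0 : 0 < β) (hβα : β < α) (hα1 : α < 1) (hQ0 : 0 ≤ Q)
    (hQ : ∀ r : ℝ, 1 < r → (r ^ β - 1) / (r - 1) ^ α ≤ Q) (hC : 0 ≤ C) (hε : 0 ≤ ε)
    {x₀ x : EuclideanSpace ℝ (Fin n)} (hx₀ : x₀ ∈ closure Ω) (hx : x₀ ≠ x) :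
    Lop Ω α (fun y => c + C * (‖y - x₀‖ ^ 2 + ε ^ 2) ^ (β / 2)) x ≤
      C * (ε ^ β / ‖x - x₀‖ ^ α - (1 - Q) * ‖x - x₀‖ ^ (β - α)) := by
  have hα0 := hβ0.trans hβα
  have hβ1 := hβα.trans hα1
  have hd : 0 < ‖x - x₀‖ := norm_pos_iff.2 (sub_ne_zero.2 hx.symm)
  have hmem : x₀ ∈ closure Ω \ {x} := ⟨hx₀, hx⟩
  have hpos : ∀ y ∈ closure Ω \ {x}, 0 < ‖y - x‖ := fun y hy =>
    norm_pos_iff.2 (sub_ne_zero.2 hy.2)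
  have htri : ∀ y, ‖y - x₀‖ - ‖x - x₀‖ ≤ ‖y - x‖ := fun y => by
    simpa using norm_sub_norm_le (y - x₀) (x - x₀)
  have htri' : ∀ y, ‖x - x₀‖ - ‖y - x₀‖ ≤ ‖y - x‖ := fun y => by
    simpa [norm_sub_rev] using norm_sub_norm_le (x - x₀) (y - x₀)
  have hplus : Lplus Ω α (fun y => c + C * (‖y - x₀‖ ^ 2 + ε ^ 2) ^ (β / 2)) x ≤
      C * (Q * ‖x - x₀‖ ^ (β - α)) := by
    refine csSup_le ⟨_, mem_image_of_mem _ hmem⟩ ?_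
    rintro _ ⟨y, hy, rfl⟩
    dsimp only
    rw [div_le_iff₀ (Real.rpow_pos_of_pos (hpos y hy) α)]
    have key : (‖y - x₀‖ ^ 2 + ε ^ 2) ^ (β / 2) - (‖x - x₀‖ ^ 2 + ε ^ 2) ^ (β / 2) ≤
        Q * ‖x - x₀‖ ^ (β - α) * ‖y - x‖ ^ α := by
      rcases le_total ‖x - x₀‖ ‖y - x₀‖ with h | h
      · exact (sq_add_sq_rpow_sub_le (norm_nonneg _) h hβ0 hβ1).trans
          (rpow_sub_rpow_le_of_ratio_le hβ0 hα0 hQ0 hQ hd (norm_nonneg _) (norm_nonneg _) (htri y))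
      · have h1 := sq_add_sq_rpow_mono (e := ε) (norm_nonneg _) h hβ0
        have : 0 ≤ Q * ‖x - x₀‖ ^ (β - α) * ‖y - x‖ ^ α := by positivity
        linarith
    linarith [mul_le_mul_of_nonneg_left key hC]
  have hminus : Lminus Ω α (fun y => c + C * (‖y - x₀‖ ^ 2 + ε ^ 2) ^ (β / 2)) x ≤
      C * (ε ^ β / ‖x - x₀‖ ^ α - ‖x - x₀‖ ^ (β - α)) := by
    have hbdd : BddBelow ((fun y => ((c + C * (‖y - x₀‖ ^ 2 + ε ^ 2) ^ (β / 2)) -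
        (c + C * (‖x - x₀‖ ^ 2 + ε ^ 2) ^ (β / 2))) / ‖y - x‖ ^ α) '' (closure Ω \ {x})) := by
      refine ⟨-(C * ‖x - x₀‖ ^ (β - α)), ?_⟩
      rintro _ ⟨y, hy, rfl⟩
      dsimp only
      rw [le_div_iff₀ (Real.rpow_pos_of_pos (hpos y hy) α)]
      have key : (‖x - x₀‖ ^ 2 + ε ^ 2) ^ (β / 2) - (‖y - x₀‖ ^ 2 + ε ^ 2) ^ (β / 2) ≤
          ‖x - x₀‖ ^ (β - α) * ‖y - x‖ ^ α := by
        rcases le_total ‖y - x₀‖ ‖x - x₀‖ with h | h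
        · exact (sq_add_sq_rpow_sub_le (norm_nonneg _) h hβ0 hβ1).trans
            (rpow_sub_rpow_le hβ0 hβα hα1 hd (norm_nonneg _) (norm_nonneg _) (htri' y))
        · have h1 := sq_add_sq_rpow_mono (e := ε) (norm_nonneg _) h hβ0
          have : 0 ≤ ‖x - x₀‖ ^ (β - α) * ‖y - x‖ ^ α := by positivity
          linarith
      linarith [mul_le_mul_of_nonneg_left key hC]
    refine (csInf_le hbdd (mem_image_of_mem _ hmem)).trans ?_
    have hdα := Real.rpow_pos_of_pos hd α
    have h0 : (‖x₀ - x₀‖ ^ 2 + ε ^ 2) ^ (β / 2) = ε ^ β := by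
      rw [sub_self, norm_zero, zero_pow two_ne_zero, zero_add, sq_rpow_half hε]
    have h1 : ‖x - x₀‖ ^ β ≤ (‖x - x₀‖ ^ 2 + ε ^ 2) ^ (β / 2) := by
      rw [← sq_rpow_half (norm_nonneg (x - x₀))]
      gcongr
      linarith [sq_nonneg ε]
    rw [h0, norm_sub_rev x₀ x, Real.rpow_sub hd, ← sub_div, mul_div_assoc']
    refine div_le_div_of_nonneg_right ?_ hdα.le
    linarith [mul_le_mul_of_nonneg_left h1 hC]
  calc Lop Ω α (fun y => c + C * (‖y - x₀‖ ^ 2 + ε ^ 2) ^ (β / 2)) x ≤ _ := add_le_add hplus hminus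
    _ = _ := by ring

theorem contDiff_barrier {n : ℕ} {β C c ε : ℝ} (hε : 0 < ε) (x₀ : EuclideanSpace ℝ (Fin n)) :
    ContDiff ℝ 1 (fun y => c + C * (‖y - x₀‖ ^ 2 + ε ^ 2) ^ (β / 2)) := by
  refine contDiff_const.add (contDiff_const.mul (ContDiff.rpow_const_of_ne ?_ fun y => ?_))
  · exact ((contDiff_id.sub contDiff_const).norm_sq ℝ).add contDiff_const
  · positivity

/-- A subsolution lying below a power barrier on the boundary lies below it everywhere, provided
the barrier is steep enough. The vertex may be any point of the closed domain. -/
theorem IsViscositySubsolution.le_add_rpow {n : ℕ} {Ω : Set (EuclideanSpace ℝ (Fin n))}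
    (hΩo : IsOpen Ω) (hΩb : Bornology.IsBounded Ω) {α β Q : ℝ}
    (hβ0 : 0 < β) (hβα : β < α) (hα1 : α < 1) (hQ0 : 0 ≤ Q) (hQ1 : Q < 1)
    (hQ : ∀ r : ℝ, 1 < r → (r ^ β - 1) / (r - 1) ^ α ≤ Q)
    {f : ℝ → ℝ} (hf : Monotone f) {u : EuclideanSpace ℝ (Fin n) → ℝ}
    (huc : ContinuousOn u (closure Ω)) (hu : IsViscositySubsolution Ω Ω α f u)
    {x₀ : EuclideanSpace ℝ (Fin n)} (hx₀ : x₀ ∈ closure Ω) {C : ℝ} (hC : 0 < C)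
    (hsteep : -f (u x₀) < C * ((1 - Q) * Metric.diam Ω ^ (β - α)))
    (hbd : ∀ y ∈ frontier Ω, u y ≤ u x₀ + C * ‖y - x₀‖ ^ β) :
    ∀ y ∈ closure Ω, u y ≤ u x₀ + C * ‖y - x₀‖ ^ β := by
  by_contra! hcon
  obtain ⟨z, hz, hzlt⟩ := hcon
  have hα0 := hβ0.trans hβα
  obtain ⟨M, hM⟩ : ∃ M, M = u z - (u x₀ + C * ‖z - x₀‖ ^ β) := ⟨_, rfl⟩
  have hM0 : 0 < M := by linarith
  obtain ⟨δ, hδ0, hδ⟩ := Metric.continuousWithinAt_iff.1 (huc x₀ hx₀) (M / 2) (by linarith)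
  -- choice of the regularisation parameter
  have hlim : Filter.Tendsto (fun ε : ℝ => ε ^ β) (nhdsWithin 0 (Ioi 0)) (nhds 0) := by
    have h := (Real.continuousAt_rpow_const 0 β (Or.inr hβ0.le)).tendsto
    rw [Real.zero_rpow hβ0.ne'] at h
    exact h.mono_left nhdsWithin_le_nhds
  have hlim1 : Filter.Tendsto (fun ε : ℝ => C * ε ^ β) (nhdsWithin 0 (Ioi 0)) (nhds 0) := by
    simpa using hlim.const_mul C
  have hlim2 : Filter.Tendsto
      (fun ε : ℝ => C * (ε ^ β / δ ^ α - (1 - Q) * Metric.diam Ω ^ (β - α)))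
      (nhdsWithin 0 (Ioi 0)) (nhds (-(C * ((1 - Q) * Metric.diam Ω ^ (β - α))))) := by
    have := ((hlim.div_const (δ ^ α)).sub_const ((1 - Q) * Metric.diam Ω ^ (β - α))).const_mul C
    simpa using this
  obtain ⟨ε, ⟨hε1, hε2⟩, hε0⟩ :=
    (((hlim1.eventually_lt_const (by linarith : (0 : ℝ) < M / 2)).and
      (hlim2.eventually_lt_const (by linarith :
        -(C * ((1 - Q) * Metric.diam Ω ^ (β - α))) < f (u x₀)))).and
      self_mem_nhdsWithin).exists
  replace hε0 : 0 < ε := hε0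
  have hcomp : IsCompact (closure Ω) := hΩb.isCompact_closure
  have hwc : Continuous fun y : EuclideanSpace ℝ (Fin n) =>
      0 + C * (‖y - x₀‖ ^ 2 + ε ^ 2) ^ (β / 2) := (contDiff_barrier hε0 x₀).continuous
  obtain ⟨x, hx, hxmax⟩ := hcomp.exists_isMaxOn ⟨x₀, hx₀⟩ (huc.sub hwc.continuousOn)
  have hmax : ∀ y ∈ closure Ω, u y - C * (‖y - x₀‖ ^ 2 + ε ^ 2) ^ (β / 2) ≤
      u x - C * (‖x - x₀‖ ^ 2 + ε ^ 2) ^ (β / 2) := fun y hy => by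
    simpa using hxmax hy
  have hlow : ‖x - x₀‖ ^ β ≤ (‖x - x₀‖ ^ 2 + ε ^ 2) ^ (β / 2) := by
    rw [← sq_rpow_half (norm_nonneg (x - x₀))]
    gcongr
    linarith [sq_nonneg ε]
  have hup : (‖z - x₀‖ ^ 2 + ε ^ 2) ^ (β / 2) ≤ ‖z - x₀‖ ^ β + ε ^ β := by
    rw [← sq_rpow_half (norm_nonneg (z - x₀)), ← sq_rpow_half (t := ε) hε0.le]
    exact Real.rpow_add_le_add_rpow (sq_nonneg _) (sq_nonneg _) (by linarith) (by linarith)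
  have hbig : u x₀ + M / 2 + C * ‖x - x₀‖ ^ β < u x := by
    linarith [hmax z hz, mul_le_mul_of_nonneg_left hlow hC.le,
      mul_le_mul_of_nonneg_left hup hC.le]
  have hnn : 0 ≤ C * ‖x - x₀‖ ^ β := by positivity
  have hxΩ : x ∈ Ω := by
    by_contra hxn
    have hfr : x ∈ frontier Ω := by
      rw [hΩo.frontier_eq]
      exact ⟨hx, hxn⟩
    linarith [hbd x hfr]
  have hδd : δ ≤ ‖x - x₀‖ := by
    by_contra! hlt
    have h := hδ hx (by rwa [dist_eq_norm])
    rw [Real.dist_eq] at h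
    linarith [le_abs_self (u x - u x₀)]
  have hd0 : 0 < ‖x - x₀‖ := hδ0.trans_le hδd
  have hne : x₀ ≠ x := fun h => by simp [h] at hd0
  have hddiam : ‖x - x₀‖ ≤ Metric.diam Ω := by
    rw [← dist_eq_norm, ← Metric.diam_closure]
    exact Metric.dist_le_diam_of_mem hΩb.closure hx hx₀
  have hvisc := hu.2
    (fun y => (u x - C * (‖x - x₀‖ ^ 2 + ε ^ 2) ^ (β / 2)) +
      C * (‖y - x₀‖ ^ 2 + ε ^ 2) ^ (β / 2))
    (contDiff_barrier hε0 x₀).contDiffOn (contDiff_barrier hε0 x₀).continuous.continuousOn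
    (fun y hy => by linarith [hmax y hy]) x hxΩ (by ring)
  have hop := Lop_barrier_le (c := u x - C * (‖x - x₀‖ ^ 2 + ε ^ 2) ^ (β / 2))
    hβ0 hβα hα1 hQ0 hQ hC.le hε0.le hx₀ hne
  rw [sub_add_cancel] at hvisc
  have hfx : f (u x₀) ≤ f (u x) := hf (by linarith)
  have hpow1 : ε ^ β / ‖x - x₀‖ ^ α ≤ ε ^ β / δ ^ α := by gcongr
  have hpow2 : Metric.diam Ω ^ (β - α) ≤ ‖x - x₀‖ ^ (β - α) :=
    Real.rpow_le_rpow_of_nonpos hd0 hddiam (by linarith)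
  have hpow3 := mul_le_mul_of_nonneg_left hpow2 (sub_nonneg.2 hQ1.le)
  have hfin : C * (ε ^ β / ‖x - x₀‖ ^ α - (1 - Q) * ‖x - x₀‖ ^ (β - α)) ≤
      C * (ε ^ β / δ ^ α - (1 - Q) * Metric.diam Ω ^ (β - α)) :=
    mul_le_mul_of_nonneg_left (by linarith) hC.le
  linarith

theorem IsViscositySubsolution.le_add_rpow_of_le {n : ℕ} {Ω : Set (EuclideanSpace ℝ (Fin n))}
    (hΩo : IsOpen Ω) (hΩb : Bornology.IsBounded Ω) (hdiam : 0 < Metric.diam Ω) {α β Q : ℝ}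
    (hβ0 : 0 < β) (hβα : β < α) (hα1 : α < 1) (hQ0 : 0 ≤ Q) (hQ1 : Q < 1)
    (hQ : ∀ r : ℝ, 1 < r → (r ^ β - 1) / (r - 1) ^ α ≤ Q)
    {f : ℝ → ℝ} (hf : Monotone f) {u : EuclideanSpace ℝ (Fin n) → ℝ}
    (huc : ContinuousOn u (closure Ω)) (hu : IsViscositySubsolution Ω Ω α f u)
    {x₀ : EuclideanSpace ℝ (Fin n)} (hx₀ : x₀ ∈ closure Ω) {C B : ℝ} (hB0 : 0 ≤ B)
    (hB : -f (u x₀) ≤ B) (hC : Metric.diam Ω ^ (α - β) * B / (1 - Q) ≤ C)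
    (hbd : ∀ y ∈ frontier Ω, u y ≤ u x₀ + C * ‖y - x₀‖ ^ β) :
    ∀ y ∈ closure Ω, u y ≤ u x₀ + C * ‖y - x₀‖ ^ β := by
  intro y hy
  have hQ' : 0 < 1 - Q := by linarith
  have hC0 : 0 ≤ C := le_trans (by positivity) hC
  have hlim : Filter.Tendsto (fun c : ℝ => u x₀ + c * ‖y - x₀‖ ^ β) (nhdsWithin C (Ioi C))
      (nhds (u x₀ + C * ‖y - x₀‖ ^ β)) :=
    (Continuous.tendsto (by fun_prop) C).mono_left nhdsWithin_le_nhds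
  refine ge_of_tendsto hlim (Filter.eventually_of_mem self_mem_nhdsWithin fun c hc => ?_)
  replace hc : C < c := hc
  refine hu.le_add_rpow hΩo hΩb hβ0 hβα hα1 hQ0 hQ1 hQ hf huc hx₀ (hC0.trans_lt hc) ?_ ?_ y hy
  · have hD := Real.rpow_pos_of_pos hdiam (α - β)
    have h := hC.trans_lt hc
    rw [div_lt_iff₀ hQ'] at h
    rw [show β - α = -(α - β) by ring, Real.rpow_neg hdiam.le, ← mul_assoc, ← div_eq_mul_inv,
      lt_div_iff₀ hD]
    linarith [mul_le_mul_of_nonneg_right hB hD.le]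
  · intro y hy
    have : C * ‖y - x₀‖ ^ β ≤ c * ‖y - x₀‖ ^ β := by gcongr
    linarith [hbd y hy]

/-- A Hölder bound between a point of the closed domain and the boundary extends to the whole
closed domain. -/
theorem abs_sub_le_rpow_of_viscosity {n : ℕ} {Ω : Set (EuclideanSpace ℝ (Fin n))}
    (hΩo : IsOpen Ω) (hΩb : Bornology.IsBounded Ω) (hdiam : 0 < Metric.diam Ω) {α β Q : ℝ}
    (hβ0 : 0 < β) (hβα : β < α) (hα1 : α < 1) (hQ0 : 0 ≤ Q) (hQ1 : Q < 1)
    (hQ : ∀ r : ℝ, 1 < r → (r ^ β - 1) / (r - 1) ^ α ≤ Q)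
    {f : ℝ → ℝ} (hf : Monotone f) {u : EuclideanSpace ℝ (Fin n) → ℝ}
    (huc : ContinuousOn u (closure Ω)) (hsub : IsViscositySubsolution Ω Ω α f u)
    (hsup : IsViscositySupersolution Ω Ω α f u)
    {x₀ : EuclideanSpace ℝ (Fin n)} (hx₀ : x₀ ∈ closure Ω) {C M : ℝ} (hM : |u x₀| ≤ M)
    (hC₁ : Metric.diam Ω ^ (α - β) * max (f M) 0 / (1 - Q) ≤ C)
    (hC₂ : Metric.diam Ω ^ (α - β) * max (-f (-M)) 0 / (1 - Q) ≤ C)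
    (hbd : ∀ y ∈ frontier Ω, |u y - u x₀| ≤ C * ‖y - x₀‖ ^ β) :
    ∀ y ∈ closure Ω, |u y - u x₀| ≤ C * ‖y - x₀‖ ^ β := by
  obtain ⟨hM1, hM2⟩ := abs_le.1 hM
  intro y hy
  have h1 := hsub.le_add_rpow_of_le hΩo hΩb hdiam hβ0 hβα hα1 hQ0 hQ1 hQ hf huc hx₀
    (le_max_right _ _) ((neg_le_neg (hf hM1)).trans (le_max_left _ _)) hC₂
    (fun y hy => by linarith [le_abs_self (u y - u x₀), hbd y hy]) y hy
  have h2 := hsup.neg.le_add_rpow_of_le (u := fun x => -u x) hΩo hΩb hdiam hβ0 hβα hα1 hQ0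
    hQ1 hQ
    (fun a b hab => neg_le_neg (hf (neg_le_neg hab))) huc.neg hx₀
    (le_max_right _ _) (by simpa using Or.inl (hf hM2)) hC₁
    (fun y hy => by linarith [neg_abs_le (u y - u x₀), hbd y hy]) y hy
  exact abs_le.2 ⟨by linarith, by linarith⟩

/-- Global β-Hölder boundary estimate for continuous viscosity solutions of
`L[u] = f(u)` with boundary datum `g ∈ C^{0,β}(∂Ω)`: for all `x ∈ Ω̄`,
`x₀ ∈ ∂Ω`, `|u(x) − u(x₀)| ≤ C ‖x − x₀‖^β` with the explicit constant
`C = max ([g]_{β,∂Ω}) (max (diam^{α−β}(f(‖g‖_∞))₊/(1−Ψ(rs))) (diam^{α−β}(f(−‖g‖_∞))₋/(1−Ψ(rs))))`;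
consequently `u ∈ C^{0,β}(Ω̄)`. -/
theorem stmt_15 (n : ℕ) (hn : 1 ≤ n) (Ω : Set (EuclideanSpace ℝ (Fin n)))
    (hΩo : IsOpen Ω) (hΩne : Ω.Nonempty) (hΩb : Bornology.IsBounded Ω)
    (α β : ℝ) (hβ0 : 0 < β) (hβα : β < α) (hα1 : α < 1)
    (rs : ℝ) (hrs : 1 < rs)
    (heq : (α - β) * rs ^ β + β * rs ^ (β - 1) - α = 0)
    (f : ℝ → ℝ) (hf : Monotone f)
    (g : EuclideanSpace ℝ (Fin n) → ℝ) (hgc : ContinuousOn g (frontier Ω))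
    (K : ℝ)
    (hK : IsLUB ((fun p : EuclideanSpace ℝ (Fin n) × EuclideanSpace ℝ (Fin n) =>
      |g p.1 - g p.2| / ‖p.1 - p.2‖ ^ β) ''
      {p | p.1 ∈ frontier Ω ∧ p.2 ∈ frontier Ω ∧ p.1 ≠ p.2}) K)
    (Mg : ℝ) (hMg : IsLUB ((fun x => |g x|) '' frontier Ω) Mg)
    (u : EuclideanSpace ℝ (Fin n) → ℝ) (huc : ContinuousOn u (closure Ω))
    (husub : IsViscositySubsolution Ω Ω α f u)
    (husup : IsViscositySupersolution Ω Ω α f u)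
    (hbd : ∀ x ∈ frontier Ω, u x = g x) :
    (∀ x ∈ closure Ω, ∀ x₀ ∈ frontier Ω,
      |u x - u x₀| ≤
        max K (max
          (Metric.diam Ω ^ (α - β) * max (f Mg) 0 /
            (1 - (rs ^ β - 1) / (rs - 1) ^ α))
          (Metric.diam Ω ^ (α - β) * max (-f (-Mg)) 0 /
            (1 - (rs ^ β - 1) / (rs - 1) ^ α))) * ‖x - x₀‖ ^ β) ∧
    ∃ C : ℝ, ∀ x ∈ closure Ω, ∀ y ∈ closure Ω,
      |u x - u y| ≤ C * ‖x - y‖ ^ β := by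
  have hQ0 := ratio_nonneg (α := α) hβ0 hrs
  have hQ1 := ratio_lt_one hβ0 hβα hα1 hrs
  have hQ : ∀ r : ℝ, 1 < r → (r ^ β - 1) / (r - 1) ^ α ≤ (rs ^ β - 1) / (rs - 1) ^ α :=
    fun r hr => ratio_le_critical hβ0 hβα hrs heq hr
  have hdiam : 0 < Metric.diam Ω := by
    obtain ⟨_, z, hz, rfl⟩ := hMg.nonempty
    obtain ⟨w, hw⟩ := hΩne
    have hne : z ≠ w := by
      rintro rfl
      rw [hΩo.frontier_eq] at hz
      exact hz.2 hw
    rw [← Metric.diam_closure]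
    exact (dist_pos.2 hne).trans_le (Metric.dist_le_diam_of_mem hΩb.closure
      (frontier_subset_closure hz) (subset_closure hw))
  generalize (rs ^ β - 1) / (rs - 1) ^ α = Q at hQ0 hQ1 hQ ⊢
  have hboundary : ∀ x ∈ frontier Ω, ∀ y ∈ frontier Ω, |u y - u x| ≤ K * ‖y - x‖ ^ β := by
    intro x hx y hy
    rcases eq_or_ne y x with rfl | hne
    · simp [Real.zero_rpow hβ0.ne']
    · rw [hbd x hx, hbd y hy, ← div_le_iff₀
        (Real.rpow_pos_of_pos (norm_pos_iff.2 (sub_ne_zero.2 hne)) β)]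
      exact hK.1 ⟨(y, x), ⟨hy, hx, hne⟩, rfl⟩
  generalize hC : max K (max (Metric.diam Ω ^ (α - β) * max (f Mg) 0 / (1 - Q))
    (Metric.diam Ω ^ (α - β) * max (-f (-Mg)) 0 / (1 - Q))) = C
  obtain ⟨hKC, hC₁, hC₂⟩ : K ≤ C ∧ Metric.diam Ω ^ (α - β) * max (f Mg) 0 / (1 - Q) ≤ C ∧
      Metric.diam Ω ^ (α - β) * max (-f (-Mg)) 0 / (1 - Q) ≤ C := by
    simpa only [max_le_iff] using hC.le
  have hfirst : ∀ x ∈ closure Ω, ∀ x₀ ∈ frontier Ω, |u x - u x₀| ≤ C * ‖x - x₀‖ ^ β := by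
    intro x hx x₀ hx₀
    refine abs_sub_le_rpow_of_viscosity hΩo hΩb hdiam hβ0 hβα hα1 hQ0 hQ1 hQ hf huc husub husup
      (frontier_subset_closure hx₀) ?_ hC₁ hC₂ ?_ x hx
    · rw [hbd x₀ hx₀]
      exact hMg.1 ⟨x₀, hx₀, rfl⟩
    · intro y hy
      exact (hboundary x₀ hx₀ y hy).trans (by gcongr)
  refine ⟨hfirst, ?_⟩
  obtain ⟨M, hM⟩ := hΩb.isCompact_closure.exists_bound_of_continuousOn huc
  refine ⟨max C (max (Metric.diam Ω ^ (α - β) * max (f M) 0 / (1 - Q))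
    (Metric.diam Ω ^ (α - β) * max (-f (-M)) 0 / (1 - Q))), fun x hx y hy => ?_⟩
  refine abs_sub_le_rpow_of_viscosity hΩo hΩb hdiam hβ0 hβα hα1 hQ0 hQ1 hQ hf huc husub husup
    hy (hM y hy) ((le_max_left _ _).trans (le_max_right _ _))
    ((le_max_right _ _).trans (le_max_right _ _)) (fun z hz => ?_) x hx
  rw [abs_sub_comm, norm_sub_rev]
  exact (hfirst y hy z hz).trans (by gcongr; exact le_max_left _ _)
end

section
/- Let 0 < β < α < 1, assume f : ℝ → ℝ is continuous and non-decreasing, and let g ∈ C^{0,β}(∂Ω). Then there exists a function u : Ω̄ → ℝ such that u is a viscosity solution of L[u] = f(u) on Ω, u = g on ∂Ω, and u ∈ C^{0,β}(Ω̄). -/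
open Set Metric

open Filter Topology

namespace FractionalInfinityLaplacian

section Scalar

/-- Subadditivity of `t ↦ t ^ p` on the nonnegative reals for `0 ≤ p ≤ 1`. -/
lemma rpow_le_rpow_add_rpow {a b c p : ℝ} (ha : 0 ≤ a) (hb : 0 ≤ b) (hc : 0 ≤ c)
    (h : a ≤ b + c) (hp : 0 ≤ p) (hp1 : p ≤ 1) : a ^ p ≤ b ^ p + c ^ p := by
  lift b to NNReal using hb
  lift c to NNReal using hc
  refine (Real.rpow_le_rpow ha h hp).trans ?_
  exact_mod_cast NNReal.rpow_add_le_add_rpow b c hp hp1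

/-- The power `t ^ β` grows slower than `t ^ α` away from `r`, with a gain `β / α < 1`. -/
lemma rpow_sub_rpow_le {α β r t s : ℝ} (hβ : 0 < β) (hβα : β < α) (hα : α < 1)
    (hr : 0 < r) (ht : 0 ≤ t) (hs : 0 ≤ s) (h : t ≤ r + s) :
    t ^ β - r ^ β ≤ β / α * r ^ (β - α) * s ^ α := by
  have hα0 : 0 < α := hβ.trans hβα
  have h1 : t ^ α ≤ r ^ α + s ^ α := rpow_le_rpow_add_rpow ht hr.le hs h hα0.le hα.le
  have h2 : 1 + α / β * ((t / r) ^ β - 1) ≤ (t / r) ^ α := by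
    have hw : 0 ≤ (t / r) ^ β := by positivity
    have := one_add_mul_self_le_rpow_one_add (s := (t / r) ^ β - 1) (by linarith)
      (p := α / β) ((one_le_div hβ).2 hβα.le)
    rwa [add_sub_cancel, ← Real.rpow_mul (by positivity), mul_div_cancel₀ _ hβ.ne'] at this
  rw [Real.div_rpow ht hr.le, Real.div_rpow ht hr.le] at h2
  have hrβ : 0 < r ^ β := by positivity
  have hrα : 0 < r ^ α := by positivity
  rw [Real.rpow_sub hr]
  have h3 : (t ^ β - r ^ β) / r ^ β ≤ β / α * (s ^ α / r ^ α) := by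
    have e1 : (t ^ β - r ^ β) / r ^ β = t ^ β / r ^ β - 1 := by field_simp
    have e2 : t ^ α / r ^ α ≤ 1 + s ^ α / r ^ α := by
      rw [div_le_iff₀ hrα]; field_simp; exact h1
    have e3 : α / β * (t ^ β / r ^ β - 1) ≤ s ^ α / r ^ α := by linarith
    calc (t ^ β - r ^ β) / r ^ β = β / α * (α / β * (t ^ β / r ^ β - 1)) := by
          rw [e1]; field_simp
      _ ≤ _ := by gcongr
  rw [div_le_iff₀ hrβ] at h3
  calc _ ≤ _ := h3
    _ = _ := by field_simp

end Scalar

variable {n : ℕ} {Ω : Set (EuclideanSpace ℝ (Fin n))} {α : ℝ}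

/-- A Hölder bound implies continuity. -/
lemma continuousOn_of_holder {K β : ℝ} (hβ : 0 < β) {s : Set (EuclideanSpace ℝ (Fin n))}
    {u : EuclideanSpace ℝ (Fin n) → ℝ}
    (h : ∀ x ∈ s, ∀ y ∈ s, |u x - u y| ≤ K * ‖x - y‖ ^ β) : ContinuousOn u s := by
  intro x hx
  rw [ContinuousWithinAt, tendsto_iff_dist_tendsto_zero]
  have h0 : Tendsto (fun y => K * ‖y - x‖ ^ β) (𝓝[s] x) (𝓝 0) := by
    have : ContinuousAt (fun y => K * ‖y - x‖ ^ β) x := by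
      refine continuousAt_const.mul (ContinuousAt.rpow_const (by fun_prop) (Or.inr hβ.le))
    have h := this.tendsto
    rw [sub_self, norm_zero, Real.zero_rpow hβ.ne', mul_zero] at h
    exact h.mono_left nhdsWithin_le_nhds
  refine squeeze_zero' (Eventually.of_forall fun _ => dist_nonneg) ?_ h0
  filter_upwards [self_mem_nhdsWithin] with y hy
  exact h y hy x hx

/-- The difference quotient entering the fractional infinity Laplacian. -/
noncomputable def holderQuot (α : ℝ) (φ : EuclideanSpace ℝ (Fin n) → ℝ)
    (x y : EuclideanSpace ℝ (Fin n)) : ℝ :=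
  (φ y - φ x) / ‖y - x‖ ^ α

/-- Admissible test functions: `C¹` in `Ω` and continuous up to the boundary. -/
structure IsTest (Ω : Set (EuclideanSpace ℝ (Fin n))) (φ : EuclideanSpace ℝ (Fin n) → ℝ) :
    Prop where
  contDiffOn : ContDiffOn ℝ 1 φ Ω
  continuousOn : ContinuousOn φ (closure Ω)

lemma IsTest.of_contDiff {φ : EuclideanSpace ℝ (Fin n) → ℝ} (h : ContDiff ℝ 1 φ) :
    IsTest Ω φ :=
  ⟨h.contDiffOn, h.continuous.continuousOn⟩

lemma IsTest.add {φ ψ : EuclideanSpace ℝ (Fin n) → ℝ} (h : IsTest Ω φ) (h' : IsTest Ω ψ) :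
    IsTest Ω (fun x => φ x + ψ x) :=
  ⟨h.contDiffOn.add h'.contDiffOn, h.continuousOn.add h'.continuousOn⟩

lemma IsTest.neg {φ : EuclideanSpace ℝ (Fin n) → ℝ} (h : IsTest Ω φ) :
    IsTest Ω (fun x => -φ x) :=
  ⟨h.contDiffOn.neg, h.continuousOn.neg⟩

/-- The perturbation `φ + κ |· - x₀|² + C` of a test function. -/
noncomputable def quadPerturb (φ : EuclideanSpace ℝ (Fin n) → ℝ) (x₀ : EuclideanSpace ℝ (Fin n))
    (κ C : ℝ) (x : EuclideanSpace ℝ (Fin n)) : ℝ :=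
  φ x + (κ * ‖x - x₀‖ ^ 2 + C)

lemma IsTest.perturb {φ : EuclideanSpace ℝ (Fin n) → ℝ} (h : IsTest Ω φ)
    (x₀ : EuclideanSpace ℝ (Fin n)) (κ C : ℝ) : IsTest Ω (quadPerturb φ x₀ κ C) :=
  h.add (IsTest.of_contDiff
    ((contDiff_const.mul ((contDiff_id.sub contDiff_const).norm_sq ℝ)).add contDiff_const))

lemma holderQuot_quadPerturb (φ : EuclideanSpace ℝ (Fin n) → ℝ) (x₀ : EuclideanSpace ℝ (Fin n))
    (κ C : ℝ) (x y : EuclideanSpace ℝ (Fin n)) :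
    holderQuot α (quadPerturb φ x₀ κ C) x y =
      holderQuot α φ x y + κ * holderQuot α (fun z => ‖z - x₀‖ ^ 2) x y := by
  simp only [holderQuot, quadPerturb]
  ring

lemma holderQuot_self (φ : EuclideanSpace ℝ (Fin n) → ℝ) (x : EuclideanSpace ℝ (Fin n)) :
    holderQuot α φ x x = 0 := by
  simp [holderQuot]

lemma IsTest.tendsto_holderQuot (hΩo : IsOpen Ω) (hα0 : 0 < α) (hα1 : α < 1)
    {φ : EuclideanSpace ℝ (Fin n) → ℝ} (hφ : IsTest Ω φ) {x₀ y₀ : EuclideanSpace ℝ (Fin n)}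
    (hx₀ : x₀ ∈ Ω) (hy₀ : y₀ ∈ closure Ω) :
    Tendsto (fun p : EuclideanSpace ℝ (Fin n) × EuclideanSpace ℝ (Fin n) =>
      holderQuot α φ p.1 p.2) (𝓝 x₀ ×ˢ 𝓝[closure Ω] y₀) (𝓝 (holderQuot α φ x₀ y₀)) := by
  have hC : ContDiffAt ℝ 1 φ x₀ := hφ.contDiffOn.contDiffAt (hΩo.mem_nhds hx₀)
  by_cases hne : y₀ = x₀
  · subst hne
    rw [holderQuot_self]
    obtain ⟨K, t, ht, hK⟩ := hC.exists_lipschitzOnWith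
    have hle : 𝓝 y₀ ×ˢ 𝓝[closure Ω] y₀ ≤ 𝓝 (y₀, y₀) := by
      rw [nhds_prod_eq]
      exact prod_mono le_rfl nhdsWithin_le_nhds
    refine Tendsto.mono_left ?_ hle
    have h0 : Tendsto (fun p : EuclideanSpace ℝ (Fin n) × EuclideanSpace ℝ (Fin n) =>
        (K : ℝ) * ‖p.2 - p.1‖ ^ (1 - α)) (𝓝 (y₀, y₀)) (𝓝 0) := by
      have : ContinuousAt (fun p : EuclideanSpace ℝ (Fin n) × EuclideanSpace ℝ (Fin n) =>
          (K : ℝ) * ‖p.2 - p.1‖ ^ (1 - α)) (y₀, y₀) :=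
        continuousAt_const.mul (ContinuousAt.rpow_const (by fun_prop) (Or.inr (by linarith)))
      have h := this.tendsto
      simp only [sub_self, norm_zero] at h
      rwa [Real.zero_rpow (by linarith), mul_zero] at h
    refine squeeze_zero_norm' ?_ h0
    filter_upwards [prod_mem_nhds ht ht] with p hp
    by_cases hpp : p.2 = p.1
    · rw [hpp, holderQuot_self, norm_zero]
      positivity
    have hpos : 0 < ‖p.2 - p.1‖ := norm_pos_iff.2 (sub_ne_zero.2 hpp)
    have hL := hK.dist_le_mul p.2 hp.2 p.1 hp.1
    rw [Real.dist_eq, dist_eq_norm] at hL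
    rw [holderQuot, Real.norm_eq_abs, abs_div, abs_of_pos (Real.rpow_pos_of_pos hpos α),
      div_le_iff₀ (Real.rpow_pos_of_pos hpos α), mul_assoc, ← Real.rpow_add hpos]
    simpa using hL
  · have hpos : 0 < ‖y₀ - x₀‖ := norm_pos_iff.2 (sub_ne_zero.2 hne)
    have hf : Tendsto (Prod.fst : EuclideanSpace ℝ (Fin n) × EuclideanSpace ℝ (Fin n) → _)
      (𝓝 x₀ ×ˢ 𝓝[closure Ω] y₀) (𝓝 x₀) := tendsto_fst
    have hs : Tendsto (Prod.snd : EuclideanSpace ℝ (Fin n) × EuclideanSpace ℝ (Fin n) → _)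
      (𝓝 x₀ ×ˢ 𝓝[closure Ω] y₀) (𝓝[closure Ω] y₀) := tendsto_snd
    refine Tendsto.div (((hφ.continuousOn y₀ hy₀).tendsto.comp hs).sub
      (hC.continuousAt.tendsto.comp hf)) ?_ (Real.rpow_pos_of_pos hpos α).ne'
    exact (((hs.mono_right nhdsWithin_le_nhds).sub hf).norm).rpow_const (Or.inr hα0.le)

/-- The difference quotients are continuous in the second variable. -/
lemma IsTest.continuousOn_holderQuot (hΩo : IsOpen Ω) (hα0 : 0 < α) (hα1 : α < 1)
    {φ : EuclideanSpace ℝ (Fin n) → ℝ} (hφ : IsTest Ω φ) {x : EuclideanSpace ℝ (Fin n)}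
    (hx : x ∈ Ω) : ContinuousOn (holderQuot α φ x) (closure Ω) := by
  intro y hy
  exact (hφ.tendsto_holderQuot hΩo hα0 hα1 hx hy).comp
    (tendsto_const_nhds.prodMk tendsto_id)

lemma IsTest.isCompact_image (hΩo : IsOpen Ω) (hΩb : Bornology.IsBounded Ω)
    (hα0 : 0 < α) (hα1 : α < 1)
    {φ : EuclideanSpace ℝ (Fin n) → ℝ} (hφ : IsTest Ω φ) {x : EuclideanSpace ℝ (Fin n)}
    (hx : x ∈ Ω) : IsCompact (holderQuot α φ x '' closure Ω) :=
  hΩb.isCompact_closure.image_of_continuousOn (hφ.continuousOn_holderQuot hΩo hα0 hα1 hx)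

lemma closure_diff_singleton_nonempty [NeZero n] (hΩo : IsOpen Ω)
    {x : EuclideanSpace ℝ (Fin n)} (hx : x ∈ Ω) : (closure Ω \ {x}).Nonempty := by
  obtain ⟨y, hy⟩ := (𝓝[≠] x).nonempty_of_mem (sdiff_mem_nhdsWithin_compl (hΩo.mem_nhds hx) {x})
  exact ⟨y, subset_closure hy.1, hy.2⟩

lemma Lplus_le [NeZero n] (hΩo : IsOpen Ω) {φ : EuclideanSpace ℝ (Fin n) → ℝ}
    {x : EuclideanSpace ℝ (Fin n)} (hx : x ∈ Ω) {c : ℝ}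
    (h : ∀ y ∈ closure Ω, y ≠ x → holderQuot α φ x y ≤ c) : Lplus Ω α φ x ≤ c :=
  csSup_le ((closure_diff_singleton_nonempty hΩo hx).image _)
    (forall_mem_image.2 fun y hy => h y hy.1 hy.2)

lemma le_Lminus [NeZero n] (hΩo : IsOpen Ω) {φ : EuclideanSpace ℝ (Fin n) → ℝ}
    {x : EuclideanSpace ℝ (Fin n)} (hx : x ∈ Ω) {c : ℝ}
    (h : ∀ y ∈ closure Ω, y ≠ x → c ≤ holderQuot α φ x y) : c ≤ Lminus Ω α φ x :=
  le_csInf ((closure_diff_singleton_nonempty hΩo hx).image _)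
    (forall_mem_image.2 fun y hy => h y hy.1 hy.2)

lemma Lminus_neg (φ : EuclideanSpace ℝ (Fin n) → ℝ) (x : EuclideanSpace ℝ (Fin n)) :
    Lminus Ω α (fun y => -φ y) x = -Lplus Ω α φ x := by
  rw [Lminus, Lplus, ← Real.sInf_neg]
  congr 1
  rw [← Set.image_neg_eq_neg, Set.image_image]
  congr 1
  ext y
  ring

lemma Lplus_neg (φ : EuclideanSpace ℝ (Fin n) → ℝ) (x : EuclideanSpace ℝ (Fin n)) :
    Lplus Ω α (fun y => -φ y) x = -Lminus Ω α φ x := by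
  simpa using (congrArg Neg.neg (Lminus_neg (Ω := Ω) (α := α) (fun y => -φ y) x)).symm

lemma Lop_neg (φ : EuclideanSpace ℝ (Fin n) → ℝ) (x : EuclideanSpace ℝ (Fin n)) :
    Lop Ω α (fun y => -φ y) x = -Lop Ω α φ x := by
  rw [Lop, Lop, Lplus_neg, Lminus_neg]
  ring

lemma holderQuot_neg (φ : EuclideanSpace ℝ (Fin n) → ℝ) (x y : EuclideanSpace ℝ (Fin n)) :
    holderQuot α (fun z => -φ z) x y = -holderQuot α φ x y := by
  simp only [holderQuot]
  ring

lemma IsTest.holderQuot_le_Lplus [NeZero n] (hΩo : IsOpen Ω) (hΩb : Bornology.IsBounded Ω)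
    (hα0 : 0 < α) (hα1 : α < 1) {φ : EuclideanSpace ℝ (Fin n) → ℝ} (hφ : IsTest Ω φ)
    {x y : EuclideanSpace ℝ (Fin n)} (hx : x ∈ Ω) (hy : y ∈ closure Ω) :
    holderQuot α φ x y ≤ Lplus Ω α φ x := by
  have key : ∀ z ∈ closure Ω, z ≠ x → holderQuot α φ x z ≤ Lplus Ω α φ x := fun z hz hzx =>
    le_csSup ((hφ.isCompact_image hΩo hΩb hα0 hα1 hx).bddAbove.mono (image_mono sdiff_subset))
      ⟨z, ⟨hz, hzx⟩, rfl⟩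
  by_cases hyx : y = x
  · subst hyx
    have hc := hφ.continuousOn_holderQuot hΩo hα0 hα1 hx y hy
    have hmem : closure Ω ∈ 𝓝 y := mem_of_superset (hΩo.mem_nhds hx) subset_closure
    have ht : Tendsto (holderQuot α φ y) (𝓝[≠] y) (𝓝 (holderQuot α φ y y)) :=
      (hc.continuousAt hmem).tendsto.mono_left nhdsWithin_le_nhds
    refine le_of_tendsto ht ?_
    filter_upwards [sdiff_mem_nhdsWithin_compl hmem {y}] with z hz
    exact key z hz.1 hz.2
  · exact key y hy hyx

lemma IsTest.Lminus_le_holderQuot [NeZero n] (hΩo : IsOpen Ω) (hΩb : Bornology.IsBounded Ω)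
    (hα0 : 0 < α) (hα1 : α < 1) {φ : EuclideanSpace ℝ (Fin n) → ℝ} (hφ : IsTest Ω φ)
    {x y : EuclideanSpace ℝ (Fin n)} (hx : x ∈ Ω) (hy : y ∈ closure Ω) :
    Lminus Ω α φ x ≤ holderQuot α φ x y := by
  have := hφ.neg.holderQuot_le_Lplus hΩo hΩb hα0 hα1 hx hy
  rw [Lplus_neg, holderQuot_neg] at this
  linarith

/-- Monotonicity of the operator at a contact point. -/
lemma Lop_le_Lop [NeZero n] (hΩo : IsOpen Ω) (hΩb : Bornology.IsBounded Ω)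
    (hα0 : 0 < α) (hα1 : α < 1) {φ ψ : EuclideanSpace ℝ (Fin n) → ℝ} (hφ : IsTest Ω φ)
    (hψ : IsTest Ω ψ) {x : EuclideanSpace ℝ (Fin n)} (hx : x ∈ Ω)
    (hle : ∀ y ∈ closure Ω, φ y ≤ ψ y) (heq : φ x = ψ x) : Lop Ω α φ x ≤ Lop Ω α ψ x := by
  have hq : ∀ y ∈ closure Ω, holderQuot α φ x y ≤ holderQuot α ψ x y := by
    intro y hy
    have := hle y hy
    rw [holderQuot, holderQuot, heq]
    gcongr
  exact add_le_add
    (Lplus_le hΩo hx fun y hy _ => (hq y hy).trans (hψ.holderQuot_le_Lplus hΩo hΩb hα0 hα1 hx hy))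
    (le_Lminus hΩo hx fun y hy _ =>
      (hφ.Lminus_le_holderQuot hΩo hΩb hα0 hα1 hx hy).trans (hq y hy))

/-- Upper semicontinuity of the operator in the point and in the perturbation parameter. -/
lemma IsTest.eventually_Lop_quadPerturb_lt [NeZero n] (hΩo : IsOpen Ω) (hΩb : Bornology.IsBounded Ω)
    (hα0 : 0 < α) (hα1 : α < 1) {φ : EuclideanSpace ℝ (Fin n) → ℝ} (hφ : IsTest Ω φ)
    {x₀ : EuclideanSpace ℝ (Fin n)} (hx₀ : x₀ ∈ Ω) {c : ℝ} (hc : Lop Ω α φ x₀ < c) :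
    ∀ᶠ p : ℝ × EuclideanSpace ℝ (Fin n) in 𝓝 (0, x₀), ∀ C,
      Lop Ω α (quadPerturb φ x₀ p.1 C) p.2 < c := by
  obtain ⟨ε, hε, hcε⟩ : ∃ ε, 0 < ε ∧ Lop Ω α φ x₀ + 3 * ε = c :=
    ⟨(c - Lop Ω α φ x₀) / 3, by linarith, by ring⟩
  have hq : IsTest Ω (fun z => ‖z - x₀‖ ^ 2) :=
    IsTest.of_contDiff ((contDiff_id.sub contDiff_const).norm_sq ℝ)
  have hlim : ∀ y ∈ closure Ω, Tendsto
      (fun z : (ℝ × EuclideanSpace ℝ (Fin n)) × EuclideanSpace ℝ (Fin n) =>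
        holderQuot α (quadPerturb φ x₀ z.1.1 0) z.1.2 z.2)
      (𝓝 (0, x₀) ×ˢ 𝓝[closure Ω] y) (𝓝 (holderQuot α φ x₀ y)) := by
    intro y hy
    simp only [holderQuot_quadPerturb]
    have h1 : Tendsto (fun z : (ℝ × EuclideanSpace ℝ (Fin n)) × EuclideanSpace ℝ (Fin n) =>
        z.1.1) (𝓝 (0, x₀) ×ˢ 𝓝[closure Ω] y) (𝓝 0) :=
      (continuous_fst.tendsto (0, x₀)).comp tendsto_fst
    have h2 : Tendsto (fun z : (ℝ × EuclideanSpace ℝ (Fin n)) × EuclideanSpace ℝ (Fin n) =>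
        (z.1.2, z.2)) (𝓝 (0, x₀) ×ˢ 𝓝[closure Ω] y) (𝓝 x₀ ×ˢ 𝓝[closure Ω] y) :=
      ((continuous_snd.tendsto (0, x₀)).comp tendsto_fst).prodMk tendsto_snd
    simpa using ((hφ.tendsto_holderQuot hΩo hα0 hα1 hx₀ hy).comp h2).add
      (h1.mul ((hq.tendsto_holderQuot hΩo hα0 hα1 hx₀ hy).comp h2))
  have hC : ∀ κ C x y, holderQuot α (quadPerturb φ x₀ κ C) x y =
      holderQuot α (quadPerturb φ x₀ κ 0) x y := by
    intro κ C x y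
    rw [holderQuot_quadPerturb, holderQuot_quadPerturb]
  have hplus : ∀ᶠ p : ℝ × EuclideanSpace ℝ (Fin n) in 𝓝 (0, x₀), ∀ y ∈ closure Ω,
      y ∈ closure Ω → holderQuot α (quadPerturb φ x₀ p.1 0) p.2 y < Lplus Ω α φ x₀ + ε := by
    refine hΩb.isCompact_closure.eventually_forall_of_forall_eventually
      (P := fun (p : ℝ × EuclideanSpace ℝ (Fin n)) y => y ∈ closure Ω →
        holderQuot α (quadPerturb φ x₀ p.1 0) p.2 y < Lplus Ω α φ x₀ + ε) fun y hy => ?_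
    have hlt : holderQuot α φ x₀ y < Lplus Ω α φ x₀ + ε := by
      linarith [hφ.holderQuot_le_Lplus hΩo hΩb hα0 hα1 hx₀ hy]
    have := (hlim y hy).eventually_lt_const hlt
    rw [← nhdsWithin_univ, ← nhdsWithin_prod_eq, eventually_nhdsWithin_iff] at this
    filter_upwards [this] with z hz hzy
    exact hz ⟨mem_univ _, hzy⟩
  obtain ⟨_, ⟨y, ⟨hy, hyx⟩, rfl⟩, hyε⟩ := Real.lt_sInf_add_pos
    ((closure_diff_singleton_nonempty hΩo hx₀).image
      (fun y => (φ y - φ x₀) / ‖y - x₀‖ ^ α)) hε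
  have hminus : ∀ᶠ p : ℝ × EuclideanSpace ℝ (Fin n) in 𝓝 (0, x₀),
      holderQuot α (quadPerturb φ x₀ p.1 0) p.2 y < Lminus Ω α φ x₀ + ε :=
    ((hlim y hy).comp (tendsto_id.prodMk (tendsto_const_nhdsWithin hy))).eventually_lt_const hyε
  have hmem : ∀ᶠ p : ℝ × EuclideanSpace ℝ (Fin n) in 𝓝 (0, x₀), p.2 ∈ Ω :=
    (continuous_snd.tendsto (0, x₀)).eventually (hΩo.mem_nhds hx₀)
  filter_upwards [hplus, hminus, hmem] with p hp hm hpΩ C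
  have h1 : Lplus Ω α (quadPerturb φ x₀ p.1 C) p.2 ≤ Lplus Ω α φ x₀ + ε :=
    Lplus_le hΩo hpΩ fun z hz _ => by rw [hC]; exact (hp z hz hz).le
  have h2 := (hφ.perturb x₀ p.1 C).Lminus_le_holderQuot hΩo hΩb hα0 hα1 hpΩ hy
  rw [hC] at h2
  have hsum : Lop Ω α φ x₀ = Lplus Ω α φ x₀ + Lminus Ω α φ x₀ := rfl
  have hsum' : Lop Ω α (quadPerturb φ x₀ p.1 C) p.2 =
    Lplus Ω α (quadPerturb φ x₀ p.1 C) p.2 + Lminus Ω α (quadPerturb φ x₀ p.1 C) p.2 := rfl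
  linarith

/-- A uniform version of `IsTest.eventually_Lop_quadPerturb_lt` with a positive parameter. -/
lemma IsTest.exists_Lop_quadPerturb_lt [NeZero n] (hΩo : IsOpen Ω) (hΩb : Bornology.IsBounded Ω)
    (hα0 : 0 < α) (hα1 : α < 1) {φ : EuclideanSpace ℝ (Fin n) → ℝ} (hφ : IsTest Ω φ)
    {x₀ : EuclideanSpace ℝ (Fin n)} (hx₀ : x₀ ∈ Ω) {c : ℝ} (hc : Lop Ω α φ x₀ < c) :
    ∃ κ > 0, ∀ᶠ x in 𝓝 x₀, x ∈ Ω ∧ ∀ C, Lop Ω α (quadPerturb φ x₀ κ C) x < c := by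
  have h := hφ.eventually_Lop_quadPerturb_lt hΩo hΩb hα0 hα1 hx₀ hc
  rw [nhds_prod_eq] at h
  have h1 := h.curry
  have h2 : ∀ᶠ κ in 𝓝[>] (0 : ℝ), ∀ᶠ x in 𝓝 x₀, ∀ C, Lop Ω α (quadPerturb φ x₀ κ C) x < c :=
    h1.filter_mono nhdsWithin_le_nhds
  obtain ⟨κ, hκ, hκ0⟩ := (h2.and self_mem_nhdsWithin).exists
  exact ⟨κ, hκ0, (hΩo.eventually_mem hx₀).and hκ⟩

/-- Lower semicontinuity counterpart of `IsTest.exists_Lop_quadPerturb_lt`. -/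
lemma IsTest.exists_lt_Lop_quadPerturb [NeZero n] (hΩo : IsOpen Ω) (hΩb : Bornology.IsBounded Ω)
    (hα0 : 0 < α) (hα1 : α < 1) {φ : EuclideanSpace ℝ (Fin n) → ℝ} (hφ : IsTest Ω φ)
    {x₀ : EuclideanSpace ℝ (Fin n)} (hx₀ : x₀ ∈ Ω) {c : ℝ} (hc : c < Lop Ω α φ x₀) :
    ∃ κ > 0, ∀ᶠ x in 𝓝 x₀, x ∈ Ω ∧ ∀ C, c < Lop Ω α (quadPerturb φ x₀ (-κ) C) x := by
  obtain ⟨κ, hκ, h⟩ := hφ.neg.exists_Lop_quadPerturb_lt hΩo hΩb hα0 hα1 hx₀ (c := -c)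
    (by rw [Lop_neg]; linarith)
  refine ⟨κ, hκ, h.mono fun x hx => ⟨hx.1, fun C => ?_⟩⟩
  have h1 := hx.2 (-C)
  have h2 : quadPerturb (fun y => -φ y) x₀ κ (-C) = fun y => -quadPerturb φ x₀ (-κ) C y := by
    ext y
    simp only [quadPerturb]
    ring
  rw [h2, Lop_neg] at h1
  linarith

/-- A `C¹` minorant of the cone `|· - y| ^ β` that vanishes at `y` and agrees with the cone
away from `y`. -/
lemma exists_smooth_cone (β : ℝ) (y : EuclideanSpace ℝ (Fin n)) {ρ : ℝ} (hρ : 0 < ρ) :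
    ∃ h : EuclideanSpace ℝ (Fin n) → ℝ, ContDiff ℝ 1 h ∧ h y = 0 ∧
      ∀ x, 0 ≤ h x ∧ h x ≤ ‖x - y‖ ^ β ∧ (ρ ≤ ‖x - y‖ → h x = ‖x - y‖ ^ β) := by
  let χ : ContDiffBump y := ⟨ρ / 2, ρ, by linarith, by linarith⟩
  refine ⟨fun x => (1 - χ x) * ‖x - y‖ ^ β, ?_, ?_, fun x => ⟨?_, ?_, fun hx => ?_⟩⟩
  · rw [contDiff_iff_contDiffAt]
    intro x
    by_cases hxy : x = y
    · subst hxy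
      have : (fun z => (1 - χ z) * ‖z - x‖ ^ β) =ᶠ[𝓝 x] fun _ => 0 := by
        filter_upwards [χ.eventuallyEq_one] with z hz
        simp [hz]
      exact contDiffAt_const.congr_of_eventuallyEq this
    · have h0 : x - y ≠ 0 := sub_ne_zero.2 hxy
      refine (contDiffAt_const.sub χ.contDiffAt).mul ?_
      exact ((contDiffAt_id.sub contDiffAt_const).norm ℝ h0).rpow_const_of_ne
        (norm_ne_zero_iff.2 h0)
  · simp [χ.one_of_mem_closedBall (mem_closedBall_self χ.rIn_pos.le)]
  · exact mul_nonneg (sub_nonneg.2 χ.le_one) (by positivity)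
  · exact mul_le_of_le_one_left (by positivity) (by linarith [χ.nonneg' x])
  · simp only [χ.zero_of_le_dist (x := x) (by rwa [dist_eq_norm]), sub_zero, one_mul]

/-- Subsolutions that are bounded below and lie above boundary cones are Hölder continuous. -/
lemma sub_le_of_isViscositySubsolution [NeZero n] (hΩo : IsOpen Ω) (hΩb : Bornology.IsBounded Ω)
    {β : ℝ} (hβ0 : 0 < β) (hβα : β < α) (hα1 : α < 1) {f : ℝ → ℝ} (hfm : Monotone f)
    {v : EuclideanSpace ℝ (Fin n) → ℝ} (hv : IsViscositySubsolution Ω Ω α f v)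
    (hvc : ContinuousOn v (closure Ω)) {M m D : ℝ} (hM : 0 ≤ M)
    (hbd : ∀ x ∈ frontier Ω, ∀ y ∈ closure Ω, v x - M * ‖x - y‖ ^ β ≤ v y)
    (hm : ∀ x ∈ closure Ω, m ≤ v x)
    (hD : ∀ x ∈ closure Ω, ∀ y ∈ closure Ω, ‖x - y‖ ≤ D)
    (hMm : -(M * (1 - β / α) * D ^ (β - α)) < f m) :
    ∀ x ∈ closure Ω, ∀ y ∈ closure Ω, v x - v y ≤ M * ‖x - y‖ ^ β := by
  intro x hx y hy
  have hα0 : 0 < α := hβ0.trans hβα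
  by_contra! hlt
  have hconeC : Continuous fun z : EuclideanSpace ℝ (Fin n) => M * ‖z - y‖ ^ β :=
    continuous_const.mul ((by fun_prop : Continuous fun z => ‖z - y‖).rpow_const
      fun _ => Or.inr hβ0.le)
  obtain ⟨a, ha, hmax⟩ := hΩb.isCompact_closure.exists_isMaxOn ⟨x, hx⟩
    ((hvc.sub continuousOn_const).sub hconeC.continuousOn)
    (f := fun z => v z - v y - M * ‖z - y‖ ^ β)
  set s := v a - v y - M * ‖a - y‖ ^ β with hs
  have hle : ∀ z ∈ closure Ω, v z - v y - M * ‖z - y‖ ^ β ≤ s := fun z hz => hmax hz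
  have hs0 : 0 < s := by linarith [hle x hx]
  have hay : a ≠ y := by
    rintro rfl
    rw [sub_self, sub_self, norm_zero, Real.zero_rpow hβ0.ne'] at hs
    linarith
  have haΩ : a ∈ Ω := by
    by_contra hna
    have := hbd a ⟨ha, by rwa [hΩo.interior_eq]⟩ y hy
    linarith
  have hr : 0 < ‖a - y‖ := norm_pos_iff.2 (sub_ne_zero.2 hay)
  obtain ⟨ρ₀, hρ₀, hnear⟩ : ∃ ρ₀ > 0, ∀ z ∈ closure Ω, ‖z - y‖ < ρ₀ → v z < v y + s := by
    have := (hvc y hy).tendsto.eventually_lt_const (show v y < v y + s by linarith)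
    obtain ⟨ρ₀, hρ₀, h⟩ := Metric.mem_nhdsWithin_iff.1 this
    exact ⟨ρ₀, hρ₀, fun z hz hzy => h ⟨by rwa [mem_ball, dist_eq_norm], hz⟩⟩
  obtain ⟨h, hC, hy0, hh⟩ := exists_smooth_cone β y (lt_min hρ₀ hr)
  have hha : h a = ‖a - y‖ ^ β := (hh a).2.2 (min_le_right _ _)
  have hφ : IsTest Ω (fun z => v y + s + M * h z) :=
    IsTest.of_contDiff (contDiff_const.add (contDiff_const.mul hC))
  have htest := hv.2 _ hφ.contDiffOn hφ.continuousOn ?_ a haΩ (by rw [hha]; linarith)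
  swap
  · intro z hz
    rcases lt_or_ge ‖z - y‖ ρ₀ with hlt' | hge
    · have := mul_nonneg hM (hh z).1
      linarith [hnear z hz hlt']
    · rw [(hh z).2.2 ((min_le_left _ _).trans hge)]
      linarith [hle z hz]
  have hrα : 0 < ‖a - y‖ ^ α := by positivity
  have hminus : Lminus Ω α (fun z => v y + s + M * h z) a ≤ -(M * ‖a - y‖ ^ (β - α)) := by
    refine (hφ.Lminus_le_holderQuot hΩo hΩb hα0 hα1 haΩ hy).trans_eq ?_
    rw [holderQuot, hy0, hha, norm_sub_rev y a, Real.rpow_sub hr]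
    ring
  have hplus : Lplus Ω α (fun z => v y + s + M * h z) a ≤
      M * (β / α * ‖a - y‖ ^ (β - α)) := by
    refine Lplus_le hΩo haΩ fun z hz hza => ?_
    have hza' : 0 < ‖z - a‖ := norm_pos_iff.2 (sub_ne_zero.2 hza)
    rw [holderQuot, div_le_iff₀ (by positivity), hha]
    have hsc := rpow_sub_rpow_le hβ0 hβα hα1 hr (norm_nonneg (z - y)) (norm_nonneg (z - a))
      (by rw [add_comm]; exact norm_sub_le_norm_sub_add_norm_sub z a y)
    calc v y + s + M * h z - (v y + s + M * ‖a - y‖ ^ β) = M * (h z - ‖a - y‖ ^ β) := by ring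
      _ ≤ M * (β / α * ‖a - y‖ ^ (β - α) * ‖z - a‖ ^ α) := by
          gcongr
          linarith [(hh z).2.1]
      _ = _ := by ring
  have hDr : D ^ (β - α) ≤ ‖a - y‖ ^ (β - α) :=
    Real.rpow_le_rpow_of_nonpos hr (hD a ha y hy) (by linarith)
  have hc : 0 ≤ 1 - β / α := sub_nonneg.2 ((div_le_one hα0).2 hβα.le)
  have hfin : M * (1 - β / α) * D ^ (β - α) ≤ M * (1 - β / α) * ‖a - y‖ ^ (β - α) := by
    gcongr
  have hfm' : f m ≤ f (v y + s + M * h a) := hfm ((hm a ha).trans (by rw [hha]; linarith))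
  rw [Lop] at htest
  linarith

/-- A continuous pointwise supremum of subsolutions is a subsolution. -/
lemma isViscositySubsolution_of_isLUB [NeZero n] (hΩo : IsOpen Ω)
    (hΩb : Bornology.IsBounded Ω) (hα0 : 0 < α) (hα1 : α < 1) {f : ℝ → ℝ}
    (hfc : Continuous f) (hfm : Monotone f) {S : Set (EuclideanSpace ℝ (Fin n) → ℝ)}
    (hS : ∀ v ∈ S, IsViscositySubsolution Ω Ω α f v ∧ ContinuousOn v (closure Ω))
    {u : EuclideanSpace ℝ (Fin n) → ℝ} (huc : ContinuousOn u (closure Ω))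
    (hu : ∀ x ∈ closure Ω, IsLUB ((fun v => v x) '' S) (u x)) :
    IsViscositySubsolution Ω Ω α f u := by
  refine ⟨huc.upperSemicontinuousOn, fun φ hφ1 hφ0 hle x₀ hx₀ heq => ?_⟩
  have hφ : IsTest Ω φ := ⟨hφ1, hφ0⟩
  by_contra! hneg
  obtain ⟨c, hc1, hc2⟩ := exists_between (show Lop Ω α φ x₀ < f (φ x₀) by linarith)
  obtain ⟨κ, hκ, hev⟩ := hφ.exists_Lop_quadPerturb_lt hΩo hΩb hα0 hα1 hx₀ hc1
  obtain ⟨δ, hδ, hfδ⟩ : ∃ δ > 0, c < f (φ x₀ - δ) := by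
    have ht : Tendsto (fun δ => f (φ x₀ - δ)) (𝓝[>] 0) (𝓝 (f (φ x₀))) := by
      have : Continuous fun δ => f (φ x₀ - δ) := by fun_prop
      simpa using (this.tendsto 0).mono_left nhdsWithin_le_nhds
    obtain ⟨δ, h1, h2⟩ := ((ht.eventually_const_lt hc2).and self_mem_nhdsWithin).exists
    exact ⟨δ, h2, h1⟩
  have hφc : ContinuousAt φ x₀ :=
    hφ0.continuousAt (mem_of_superset (hΩo.mem_nhds hx₀) subset_closure)
  obtain ⟨r, hr, hball⟩ := Metric.eventually_nhds_iff.1 (hev.and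
    (hφc.tendsto.eventually_const_lt (show φ x₀ - δ / 2 < φ x₀ by linarith)))
  obtain ⟨_, ⟨v, hvS, rfl⟩, hv, -⟩ := (hu x₀ (subset_closure hx₀)).exists_between
    (show u x₀ - min (κ * r ^ 2) (δ / 2) < u x₀ by
      have : 0 < min (κ * r ^ 2) (δ / 2) := lt_min (by positivity) (by linarith)
      linarith)
  have hvu : ∀ x ∈ closure Ω, v x ≤ u x := fun x hx => (hu x hx).1 ⟨v, hvS, rfl⟩
  obtain ⟨a, ha, hmax⟩ := hΩb.isCompact_closure.exists_isMaxOn ⟨x₀, subset_closure hx₀⟩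
    ((hS v hvS).2.sub (hφ.perturb x₀ κ 0).continuousOn)
  have hmax' : ∀ x ∈ closure Ω, v x - quadPerturb φ x₀ κ 0 x ≤ v a - quadPerturb φ x₀ κ 0 a :=
    fun x hx => hmax hx
  have h0 := hmax' x₀ (subset_closure hx₀)
  simp only [quadPerturb, sub_self, norm_zero] at h0
  have hva := hvu a ha
  have hua := hle a ha
  have hmin1 := min_le_left (κ * r ^ 2) (δ / 2)
  have hmin2 := min_le_right (κ * r ^ 2) (δ / 2)
  have hκa : 0 ≤ κ * ‖a - x₀‖ ^ 2 := by positivity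
  have hdist : dist a x₀ < r := by
    rw [dist_eq_norm]
    refine lt_of_pow_lt_pow_left₀ 2 hr.le (lt_of_mul_lt_mul_left (a := κ) ?_ hκ.le)
    linarith
  obtain ⟨⟨haΩ, hL⟩, hφa⟩ := hball hdist
  have hT := hφ.perturb x₀ κ (v a - quadPerturb φ x₀ κ 0 a)
  have htest := (hS v hvS).1.2 _ hT.contDiffOn hT.continuousOn (fun x hx => by
    have := hmax' x hx
    simp only [quadPerturb] at this ⊢
    linarith) a haΩ (by simp only [quadPerturb]; ring)
  have hval : quadPerturb φ x₀ κ (v a - quadPerturb φ x₀ κ 0 a) a = v a := by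
    simp only [quadPerturb]; ring
  rw [hval] at htest
  have hfa : f (φ x₀ - δ) ≤ f (v a) := hfm (by linarith)
  linarith [hL (v a - quadPerturb φ x₀ κ 0 a)]

/-- A continuous subsolution that is not a supersolution can be increased in the interior. -/
lemma exists_larger_subsolution [NeZero n] (hΩo : IsOpen Ω)
    (hΩb : Bornology.IsBounded Ω) (hα0 : 0 < α) (hα1 : α < 1) {f : ℝ → ℝ}
    (hfc : Continuous f) {u : EuclideanSpace ℝ (Fin n) → ℝ} (huc : ContinuousOn u (closure Ω))
    (hu : IsViscositySubsolution Ω Ω α f u) (hnu : ¬ IsViscositySupersolution Ω Ω α f u) :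
    ∃ w : EuclideanSpace ℝ (Fin n) → ℝ, IsViscositySubsolution Ω Ω α f w ∧
      ContinuousOn w (closure Ω) ∧ (∀ x, u x ≤ w x) ∧ (∀ x ∈ frontier Ω, w x = u x) ∧
      ∃ x ∈ Ω, u x < w x := by
  simp only [IsViscositySupersolution, huc.lowerSemicontinuousOn, true_and] at hnu
  push Not at hnu
  obtain ⟨φ, hφ1, hφ0, hle, x₀, hx₀, heq, hneg⟩ := hnu
  have hφ : IsTest Ω φ := ⟨hφ1, hφ0⟩
  obtain ⟨c, hc1, hc2⟩ := exists_between (show f (φ x₀) < Lop Ω α φ x₀ by linarith)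
  obtain ⟨κ, hκ, hev⟩ := hφ.exists_lt_Lop_quadPerturb hΩo hΩb hα0 hα1 hx₀ hc2
  have hφc : ContinuousAt φ x₀ :=
    hφ0.continuousAt (mem_of_superset (hΩo.mem_nhds hx₀) subset_closure)
  obtain ⟨δ, hδ, hδf⟩ : ∃ δ > 0, ∀ t, |t - φ x₀| < δ → f t < c := by
    obtain ⟨δ, hδ, h⟩ := Metric.eventually_nhds_iff.1
      ((hfc.tendsto (φ x₀)).eventually_lt_const hc1)
    exact ⟨δ, hδ, fun t ht => h ht⟩
  obtain ⟨r, hr, hball⟩ := Metric.eventually_nhds_iff.1 (hev.and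
    ((hφ.perturb x₀ (-κ) 0).continuousOn.continuousAt
      (mem_of_superset (hΩo.mem_nhds hx₀) subset_closure) |>.tendsto.eventually
      (Metric.ball_mem_nhds _ (half_pos hδ))))
  obtain ⟨η, hη, hηr, hηδ⟩ : ∃ η > 0, η < κ * r ^ 2 ∧ η < δ / 2 := by
    obtain ⟨η, h1, h2⟩ := exists_between
      (show 0 < min (κ * r ^ 2) (δ / 2) from lt_min (by positivity) (by linarith))
    exact ⟨η, h1, lt_min_iff.1 h2⟩
  have hψ : IsTest Ω (quadPerturb φ x₀ (-κ) η) := hφ.perturb x₀ (-κ) η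
  have hin : ∀ x ∈ closure Ω, u x < quadPerturb φ x₀ (-κ) η x → dist x x₀ < r := by
    intro x hx hlt
    rw [dist_eq_norm]
    simp only [quadPerturb] at hlt
    refine lt_of_pow_lt_pow_left₀ 2 hr.le (lt_of_mul_lt_mul_left (a := κ) ?_ hκ.le)
    linarith [hle x hx]
  have hwc : ContinuousOn (fun x => max (u x) (quadPerturb φ x₀ (-κ) η x)) (closure Ω) :=
    ContinuousOn.sup huc hψ.continuousOn
  refine ⟨fun x => max (u x) (quadPerturb φ x₀ (-κ) η x),
    ⟨hwc.upperSemicontinuousOn, fun θ hθ1 hθ0 hwθ a ha hwa => ?_⟩, hwc, fun x => le_max_left _ _,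
    fun x hx => max_eq_left ?_, x₀, hx₀, lt_max_of_lt_right ?_⟩
  · rcases le_or_gt (quadPerturb φ x₀ (-κ) η a) (u a) with hcase | hcase
    · exact hu.2 θ hθ1 hθ0 (fun x hx => (le_max_left _ _).trans (hwθ x hx)) a ha
        ((max_eq_left hcase).symm.trans hwa)
    · have hψa : quadPerturb φ x₀ (-κ) η a = θ a := (max_eq_right hcase.le).symm.trans hwa
      obtain ⟨⟨-, hL⟩, hφa⟩ := hball (hin a (subset_closure ha) hcase)
      have hmono := Lop_le_Lop hΩo hΩb hα0 hα1 hψ ⟨hθ1, hθ0⟩ ha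
        (fun x hx => (le_max_right _ _).trans (hwθ x hx)) hψa
      have hfa : f (θ a) < c := by
        refine hδf _ ?_
        rw [← hψa]
        simp only [quadPerturb, Real.dist_eq, sub_self, norm_zero] at hφa ⊢
        rw [abs_lt] at hφa ⊢
        constructor <;> linarith [hφa.1, hφa.2]
      linarith [hL η]
  · by_contra! hlt
    have hxΩ := (hball (hin x (frontier_subset_closure hx) hlt)).1.1
    exact hx.2 (by rwa [hΩo.interior_eq])
  · simp only [quadPerturb, sub_self, norm_zero]
    linarith

/-- The lower barrier: an upper envelope of boundary cones is a subsolution attaining the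
boundary values. -/
lemma exists_barrier [NeZero n] (hΩo : IsOpen Ω) (hΩb : Bornology.IsBounded Ω)
    (hfr : (frontier Ω).Nonempty)
    {β : ℝ} (hβ0 : 0 < β) (hβα : β < α) (hα1 : α < 1) {f : ℝ → ℝ} (hfm : Monotone f)
    {g : EuclideanSpace ℝ (Fin n) → ℝ} {M G D : ℝ} (hM : 0 ≤ M)
    (hg : ∀ x ∈ frontier Ω, ∀ y ∈ frontier Ω, |g x - g y| ≤ M * ‖x - y‖ ^ β)
    (hG : ∀ x ∈ frontier Ω, g x ≤ G)
    (hD : ∀ x ∈ closure Ω, ∀ y ∈ closure Ω, ‖x - y‖ ≤ D)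
    (hMG : f G ≤ M * (1 - β / α) * D ^ (β - α)) :
    ∃ b : EuclideanSpace ℝ (Fin n) → ℝ, IsViscositySubsolution Ω Ω α f b ∧
      ContinuousOn b (closure Ω) ∧ (∀ x ∈ frontier Ω, b x = g x) ∧
      ∀ x, ∀ z ∈ frontier Ω, g z - M * ‖z - x‖ ^ β ≤ b x := by
  have hα0 : 0 < α := hβ0.trans hβα
  have hcpt : IsCompact (frontier Ω) :=
    hΩb.isCompact_closure.of_isClosed_subset isClosed_frontier frontier_subset_closure
  have hcone : ∀ x : EuclideanSpace ℝ (Fin n), Continuous fun z => M * ‖z - x‖ ^ β := fun x =>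
    continuous_const.mul ((by fun_prop : Continuous fun z => ‖z - x‖).rpow_const
      fun _ => Or.inr hβ0.le)
  have hex : ∀ x, ∃ z ∈ frontier Ω, ∀ z' ∈ frontier Ω,
      g z' - M * ‖z' - x‖ ^ β ≤ g z - M * ‖z - x‖ ^ β := fun x =>
    hcpt.exists_isMaxOn hfr ((continuousOn_of_holder hβ0 hg).sub (hcone x).continuousOn)
  choose Z hZ hmax using hex
  have hholder : ∀ x y, (g (Z x) - M * ‖Z x - x‖ ^ β) - (g (Z y) - M * ‖Z y - y‖ ^ β) ≤
      M * ‖x - y‖ ^ β := by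
    intro x y
    have h1 := hmax y (Z x) (hZ x)
    have h2 := rpow_le_rpow_add_rpow (p := β) (norm_nonneg (Z x - y)) (norm_nonneg (Z x - x))
      (norm_nonneg (x - y)) (norm_sub_le_norm_sub_add_norm_sub _ _ _) hβ0.le (by linarith)
    have h3 := mul_le_mul_of_nonneg_left h2 hM
    linarith
  have hbc : ContinuousOn (fun x => g (Z x) - M * ‖Z x - x‖ ^ β) (closure Ω) := by
    refine continuousOn_of_holder (K := M) hβ0 fun x _ y _ => abs_sub_le_iff.2 ⟨hholder x y, ?_⟩
    rw [norm_sub_rev x y]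
    exact hholder y x
  refine ⟨fun x => g (Z x) - M * ‖Z x - x‖ ^ β,
    ⟨hbc.upperSemicontinuousOn, fun φ hφ1 hφ0 hle a ha heq => ?_⟩, hbc, fun x hx => ?_, hmax⟩
  · have hφ : IsTest Ω φ := ⟨hφ1, hφ0⟩
    have hzc : Z a ∈ closure Ω := frontier_subset_closure (hZ a)
    have hza : a - Z a ≠ 0 := by
      refine sub_ne_zero.2 fun h => (hZ a).2 ?_
      rwa [hΩo.interior_eq, ← h]
    have hr : 0 < ‖a - Z a‖ := norm_pos_iff.2 hza
    have hrα : 0 < ‖a - Z a‖ ^ α := by positivity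
    have hlow : ∀ y ∈ closure Ω, g (Z a) - M * ‖y - Z a‖ ^ β ≤ φ y := fun y hy => by
      rw [norm_sub_rev]
      exact (hmax y (Z a) (hZ a)).trans (hle y hy)
    beta_reduce at heq
    rw [norm_sub_rev] at heq
    have hplus : M * ‖a - Z a‖ ^ (β - α) ≤ Lplus Ω α φ a := by
      refine le_trans ?_ (hφ.holderQuot_le_Lplus hΩo hΩb hα0 hα1 ha hzc)
      have := hlow (Z a) hzc
      rw [sub_self, norm_zero, Real.zero_rpow hβ0.ne'] at this
      rw [holderQuot, norm_sub_rev (Z a) a, le_div_iff₀ hrα, mul_assoc, ← Real.rpow_add hr,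
        sub_add_cancel]
      linarith
    have hminus : -(M * (β / α * ‖a - Z a‖ ^ (β - α))) ≤ Lminus Ω α φ a := by
      refine le_Lminus hΩo ha fun y hy hya => ?_
      have hya' : 0 < ‖y - a‖ := norm_pos_iff.2 (sub_ne_zero.2 hya)
      rw [holderQuot, le_div_iff₀ (by positivity)]
      have hsc := rpow_sub_rpow_le hβ0 hβα hα1 hr (norm_nonneg (y - Z a)) (norm_nonneg (y - a))
        (by rw [add_comm]; exact norm_sub_le_norm_sub_add_norm_sub y a (Z a))
      have := mul_le_mul_of_nonneg_left hsc hM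
      linarith [hlow y hy]
    have hDr : D ^ (β - α) ≤ ‖a - Z a‖ ^ (β - α) :=
      Real.rpow_le_rpow_of_nonpos hr (hD a (subset_closure ha) _ hzc) (by linarith)
    have hc : 0 ≤ 1 - β / α := sub_nonneg.2 ((div_le_one hα0).2 hβα.le)
    have hfin : M * (1 - β / α) * D ^ (β - α) ≤ M * (1 - β / α) * ‖a - Z a‖ ^ (β - α) := by
      gcongr
    have hfG : f (φ a) ≤ f G := hfm (by
      have : 0 ≤ M * ‖a - Z a‖ ^ β := by positivity
      linarith [hG _ (hZ a)])
    rw [Lop]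
    linarith
  · refine le_antisymm ?_ ?_
    · linarith [(abs_le.1 (hg (Z x) (hZ x) x hx)).2]
    · have := hmax x x hx
      rwa [sub_self, norm_zero, Real.zero_rpow hβ0.ne', mul_zero, sub_zero] at this

end FractionalInfinityLaplacian

open FractionalInfinityLaplacian in
/-- Existence (Theorem 1.1): for `f` continuous and non-decreasing and
`g ∈ C^{0,β}(∂Ω)` with `0 < β < α < 1`, there is a viscosity solution `u` of
`L[u] = f(u)` on `Ω` with `u = g` on `∂Ω` and `u ∈ C^{0,β}(Ω̄)`. -/
theorem stmt_16 (n : ℕ) (hn : 1 ≤ n) (Ω : Set (EuclideanSpace ℝ (Fin n)))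
    (hΩo : IsOpen Ω) (hΩne : Ω.Nonempty) (hΩb : Bornology.IsBounded Ω)
    (α β : ℝ) (hβ0 : 0 < β) (hβα : β < α) (hα1 : α < 1)
    (f : ℝ → ℝ) (hfc : Continuous f) (hfm : Monotone f)
    (g : EuclideanSpace ℝ (Fin n) → ℝ)
    (hg : ∃ K : ℝ, ∀ x ∈ frontier Ω, ∀ y ∈ frontier Ω,
      |g x - g y| ≤ K * ‖x - y‖ ^ β) :
    ∃ u : EuclideanSpace ℝ (Fin n) → ℝ,
      IsViscositySubsolution Ω Ω α f u ∧
      IsViscositySupersolution Ω Ω α f u ∧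
      (∀ x ∈ frontier Ω, u x = g x) ∧
      ContinuousOn u (closure Ω) ∧
      ∃ K : ℝ, ∀ x ∈ closure Ω, ∀ y ∈ closure Ω,
        |u x - u y| ≤ K * ‖x - y‖ ^ β := by
  have : NeZero n := ⟨by omega⟩
  have hα0 : 0 < α := hβ0.trans hβα
  have hfr : (frontier Ω).Nonempty :=
    nonempty_frontier_iff.2 ⟨hΩne, fun h => NormedSpace.unbounded_univ ℝ _ (h ▸ hΩb)⟩
  obtain ⟨z₀, hz₀⟩ := hfr
  have hz₀c : z₀ ∈ closure Ω := frontier_subset_closure hz₀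
  obtain ⟨D, hD0, hD⟩ : ∃ D > 0, ∀ x ∈ closure Ω, ∀ y ∈ closure Ω, ‖x - y‖ ≤ D := by
    obtain ⟨D, hD⟩ := Metric.isBounded_iff.1 hΩb.closure
    refine ⟨max D 1, by positivity, fun x hx y hy => ?_⟩
    rw [← dist_eq_norm]
    exact (hD hx hy).trans (le_max_left _ _)
  obtain ⟨K, hK⟩ := hg
  have hgap : 0 < (1 - β / α) * D ^ (β - α) :=
    mul_pos (sub_pos.2 ((div_lt_one hα0).2 hβα)) (by positivity)
  set G := g z₀ + |K| * D ^ β with hGdef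
  have hG : ∀ x ∈ frontier Ω, g x ≤ G := by
    intro x hx
    have h1 := (abs_le.1 (hK x hx z₀ hz₀)).2
    have h2 : K * ‖x - z₀‖ ^ β ≤ |K| * D ^ β := by
      gcongr
      · exact le_abs_self K
      · exact hD x (frontier_subset_closure hx) z₀ hz₀c
    linarith
  set M₀ := max |K| (f G / ((1 - β / α) * D ^ (β - α))) with hM₀def
  have hM₀ : 0 ≤ M₀ := (abs_nonneg K).trans (le_max_left _ _)
  obtain ⟨b, hbsub, hbc, hbg, hbcone⟩ := exists_barrier hΩo hΩb ⟨z₀, hz₀⟩ hβ0 hβα hα1 hfm hM₀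
    (fun x hx y hy => (hK x hx y hy).trans (by
      gcongr
      exact (le_abs_self K).trans (le_max_left _ _))) hG hD
    (by rw [mul_assoc, ← div_le_iff₀ hgap]; exact le_max_right _ _)
  set m := g z₀ - M₀ * D ^ β with hmdef
  have hbm : ∀ x ∈ closure Ω, m ≤ b x := by
    intro x hx
    refine le_trans ?_ (hbcone x z₀ hz₀)
    have := hD z₀ hz₀c x hx
    rw [hmdef]
    gcongr
  obtain ⟨M, hM₀M, hMm⟩ : ∃ M ≥ M₀, -(M * (1 - β / α) * D ^ (β - α)) < f m := by
    refine ⟨max M₀ ((1 - f m) / ((1 - β / α) * D ^ (β - α))), le_max_left _ _, ?_⟩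
    have := (div_le_iff₀ hgap).1 (le_max_right M₀ ((1 - f m) / ((1 - β / α) * D ^ (β - α))))
    rw [mul_assoc]
    linarith
  have hM : 0 ≤ M := hM₀.trans hM₀M
  let S : Set (EuclideanSpace ℝ (Fin n) → ℝ) := {v | IsViscositySubsolution Ω Ω α f v ∧
    ContinuousOn v (closure Ω) ∧ (∀ x ∈ frontier Ω, v x = g x) ∧ ∀ x ∈ closure Ω, b x ≤ v x}
  have hbS : b ∈ S := ⟨hbsub, hbc, hbg, fun _ _ => le_rfl⟩
  have hS : ∀ v ∈ S, ∀ x ∈ closure Ω, ∀ y ∈ closure Ω, v x - v y ≤ M * ‖x - y‖ ^ β := by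
    rintro v ⟨hv, hvc, hvg, hbv⟩
    refine sub_le_of_isViscositySubsolution hΩo hΩb hβ0 hβα hα1 hfm hv hvc hM
      (fun x hx y hy => ?_) (fun x hx => (hbm x hx).trans (hbv x hx)) hD hMm
    rw [hvg x hx]
    refine le_trans ?_ ((hbcone y x hx).trans (hbv y hy))
    gcongr
  have hLUB : ∀ x ∈ closure Ω, IsLUB ((fun v => v x) '' S) (sSup ((fun v => v x) '' S)) := by
    intro x hx
    refine isLUB_csSup ⟨b x, b, hbS, rfl⟩ ⟨g z₀ + M * ‖x - z₀‖ ^ β, ?_⟩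
    rintro _ ⟨v, hv, rfl⟩
    have := hS v hv x hx z₀ hz₀c
    rw [hv.2.2.1 z₀ hz₀] at this
    linarith
  set u : EuclideanSpace ℝ (Fin n) → ℝ := fun x => sSup ((fun v => v x) '' S)
  have huS : ∀ x ∈ closure Ω, ∀ y ∈ closure Ω, u x - u y ≤ M * ‖x - y‖ ^ β := by
    intro x hx y hy
    have : u x ≤ u y + M * ‖x - y‖ ^ β := by
      refine (hLUB x hx).2 ?_
      rintro _ ⟨v, hv, rfl⟩
      have h1 : v y ≤ u y := (hLUB y hy).1 ⟨v, hv, rfl⟩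
      linarith [hS v hv x hx y hy]
    linarith
  have huH : ∀ x ∈ closure Ω, ∀ y ∈ closure Ω, |u x - u y| ≤ M * ‖x - y‖ ^ β :=
    fun x hx y hy => abs_sub_le_iff.2 ⟨huS x hx y hy, by
      rw [norm_sub_rev]; exact huS y hy x hx⟩
  have huc : ContinuousOn u (closure Ω) := continuousOn_of_holder hβ0 huH
  have husub : IsViscositySubsolution Ω Ω α f u :=
    isViscositySubsolution_of_isLUB hΩo hΩb hα0 hα1 hfc hfm
      (fun v hv => ⟨hv.1, hv.2.1⟩) huc hLUB
  have hug : ∀ x ∈ frontier Ω, u x = g x := by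
    intro x hx
    have hxc := frontier_subset_closure hx
    refine le_antisymm ((hLUB x hxc).2 ?_) ?_
    · rintro _ ⟨v, hv, rfl⟩
      exact (hv.2.2.1 x hx).le
    · rw [← hbg x hx]
      exact (hLUB x hxc).1 ⟨b, hbS, rfl⟩
  refine ⟨u, husub, ?_, hug, huc, M, huH⟩
  by_contra hnsup
  obtain ⟨w, hw, hwc, huw, hwu, x, hx, hlt⟩ :=
    exists_larger_subsolution hΩo hΩb hα0 hα1 hfc huc husub hnsup
  have hwS : w ∈ S := ⟨hw, hwc, fun y hy => (hwu y hy).trans (hug y hy),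
    fun y hy => ((hLUB y hy).1 ⟨b, hbS, rfl⟩).trans (huw y)⟩
  exact absurd ((hLUB x (subset_closure hx)).1 ⟨w, hwS, rfl⟩) (not_le.2 hlt)
end

section
/- Let 0 < β < α < 1, assume f : ℝ → ℝ is continuous, non-decreasing, and nonnegative on [0, ∞), and let g ∈ C^{0,β}(∂Ω) with g ≥ 0 on ∂Ω. Then there exists a function u : Ω̄ → ℝ with u ≥ 0 on Ω̄, u ∈ C^{0,β}(Ω̄), u = g on ∂Ω, and such that u is a viscosity solution of L[u] = f(u) on the open set {x ∈ Ω : u(x) > 0}. -/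
open Set Metric

section PowerInequalities

theorem one_add_rpow_sub_one_le {α β s : ℝ} (hβ : 0 < β) (hβα : β < α) (hα : α < 1)
    (hs : 0 ≤ s) : (1 + s) ^ β - 1 ≤ β / α * s ^ α := by
  have hα0 : 0 < α := hβ.trans hβα
  have hββα : β ≤ β / α := by
    rw [le_div_iff₀ hα0]; nlinarith
  rcases le_total s 1 with h1 | h1
  · have h := rpow_one_add_le_one_add_mul_self (s := s) (by linarith) hβ.le (by linarith)
    have h2 : s ≤ s ^ α := by
      rcases hs.eq_or_lt with rfl | hs
      · simp [Real.zero_rpow hα0.ne']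
      · simpa using Real.rpow_le_rpow_of_exponent_ge hs h1 hα.le
    have h3 : β * s ≤ β / α * s ^ α := mul_le_mul hββα h2 hs (by positivity)
    linarith
  · have hs0 : 0 < s := by linarith
    have e : (1 + s) ^ β = s ^ β * (1 + 1 / s) ^ β := by
      rw [← Real.mul_rpow hs (by positivity)]
      congr 1
      field_simp
      ring
    have hinv : (0 : ℝ) < 1 / s := by positivity
    have h := rpow_one_add_le_one_add_mul_self (s := 1 / s) (by linarith) hβ.le
      (by linarith)
    have hb : s ^ β * (1 / s) ≤ 1 := by
      rw [mul_one_div, div_le_one hs0]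
      simpa using Real.rpow_le_rpow_of_exponent_le h1 (show β ≤ 1 by linarith)
    have hp : s ^ β ≤ 1 + β / α * (s ^ α - 1) := by
      have h1a : 1 ≤ s ^ α := Real.one_le_rpow h1 hα0.le
      have := rpow_one_add_le_one_add_mul_self (s := s ^ α - 1) (p := β / α)
        (by linarith) (by positivity) ((div_le_one hα0).2 hβα.le)
      rw [add_sub_cancel, ← Real.rpow_mul hs, mul_div_cancel₀ _ hα0.ne'] at this
      exact this
    have hsβ : 0 < s ^ β := by positivity
    have : s ^ β * (1 + 1 / s) ^ β ≤ s ^ β * (1 + β * (1 / s)) :=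
      mul_le_mul_of_nonneg_left h hsβ.le
    rw [e]
    nlinarith

theorem add_rpow_sub_rpow_le {α β r t : ℝ} (hβ : 0 < β) (hβα : β < α) (hα : α < 1)
    (hr : 0 < r) (ht : 0 ≤ t) :
    (r + t) ^ β - r ^ β ≤ β / α * r ^ (β - α) * t ^ α := by
  have h := one_add_rpow_sub_one_le hβ hβα hα (div_nonneg ht hr.le)
  have e : (r + t) ^ β = r ^ β * (1 + t / r) ^ β := by
    rw [← Real.mul_rpow hr.le (by positivity)]
    congr 1
    field_simp
  rw [Real.div_rpow ht hr.le] at h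
  rw [e, Real.rpow_sub hr]
  have hrβ : 0 < r ^ β := by positivity
  calc _ = r ^ β * ((1 + t / r) ^ β - 1) := by ring
    _ ≤ r ^ β * (β / α * (t ^ α / r ^ α)) := mul_le_mul_of_nonneg_left h hrβ.le
    _ = _ := by ring

theorem add_rpow_sub_rpow_le_linear {β r t : ℝ} (hβ : 0 < β) (hβ1 : β < 1)
    (hr : 0 < r) (ht : 0 ≤ t) :
    (r + t) ^ β - r ^ β ≤ r ^ β / r * t := by
  have h := rpow_one_add_le_one_add_mul_self (s := t / r) (p := β)
    (by linarith [div_nonneg ht hr.le]) hβ.le hβ1.le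
  have e : (r + t) ^ β = r ^ β * (1 + t / r) ^ β := by
    rw [← Real.mul_rpow hr.le (by positivity)]
    congr 1
    field_simp
  rw [e]
  have hrβ : 0 < r ^ β := by positivity
  have htr : 0 ≤ t / r := by positivity
  calc _ = r ^ β * ((1 + t / r) ^ β - 1) := by ring
    _ ≤ r ^ β * (t / r) := mul_le_mul_of_nonneg_left (by nlinarith) hrβ.le
    _ = _ := by ring

end PowerInequalities

section PointwiseSolutions

variable {E : Type*} [NormedAddCommGroup E]

/-- The `α`-Hölder difference quotient of `u` between `x` and `y`. -/
noncomputable def holderQuot (α : ℝ) (u : E → ℝ) (x y : E) : ℝ :=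
  (u y - u x) / ‖y - x‖ ^ α

/-- Pointwise form of the subsolution property at `x`, required only where `u` can be touched
from above by a Lipschitz cone with vertex `x`. -/
def SubsolutionAt (K : Set E) (α : ℝ) (f : ℝ → ℝ) (u : E → ℝ) (x : E) : Prop :=
  ∀ M : ℝ, (∀ y ∈ K, u y ≤ u x + M * ‖y - x‖) → ∀ y ∈ K, y ≠ x →
    0 < f (u x) - holderQuot α u x y →
    ∃ z ∈ K, z ≠ x ∧ f (u x) - holderQuot α u x y ≤ holderQuot α u x z

/-- Pointwise form of the supersolution property at `x`, required only where `u` can be touched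
from below by a Lipschitz cone with vertex `x`. -/
def SupersolutionAt (K : Set E) (α : ℝ) (f : ℝ → ℝ) (u : E → ℝ) (x : E) : Prop :=
  ∀ M : ℝ, (∀ y ∈ K, u x - M * ‖y - x‖ ≤ u y) → ∀ y ∈ K, y ≠ x →
    f (u x) - holderQuot α u x y < 0 →
    ∃ z ∈ K, z ≠ x ∧ holderQuot α u x z ≤ f (u x) - holderQuot α u x y

theorem norm_sub_rpow_pos {x y : E} (h : y ≠ x) (α : ℝ) : 0 < ‖y - x‖ ^ α :=
  Real.rpow_pos_of_pos (norm_pos_iff.2 (sub_ne_zero.2 h)) α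

/-- One-sided Hölder bound that is symmetric in the two points. -/
def HolderBound (K : Set E) (C β : ℝ) (u : E → ℝ) : Prop :=
  ∀ x ∈ K, ∀ y ∈ K, u y ≤ u x + C * ‖y - x‖ ^ β

theorem HolderBound.abs_sub_le {K : Set E} {C β : ℝ} {u : E → ℝ} (h : HolderBound K C β u)
    {x y : E} (hx : x ∈ K) (hy : y ∈ K) : |u x - u y| ≤ C * ‖x - y‖ ^ β := by
  have h1 := h x hx y hy
  have h2 := h y hy x hx
  rw [norm_sub_rev] at h1
  exact abs_le.2 ⟨by linarith, by linarith⟩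

theorem HolderBound.continuousOn {K : Set E} {C β : ℝ} {u : E → ℝ} (hβ : 0 < β)
    (h : HolderBound K C β u) : ContinuousOn u K := by
  intro x hx
  have ht : Filter.Tendsto (fun y => C * ‖y - x‖ ^ β) (nhdsWithin x K) (nhds 0) := by
    have hc : Continuous fun y : E => C * ‖y - x‖ ^ β :=
      continuous_const.mul ((continuous_id.sub continuous_const).norm.rpow_const
        fun _ => Or.inr hβ.le)
    have := (hc.tendsto x).mono_left (nhdsWithin_le_nhds (s := K))
    simpa [Real.zero_rpow hβ.ne'] using this
  refine tendsto_iff_dist_tendsto_zero.2 (squeeze_zero' (Filter.Eventually.of_forall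
    fun _ => dist_nonneg) ?_ ht)
  filter_upwards [self_mem_nhdsWithin] with y hy
  exact h.abs_sub_le hy hx

/-- A subsolution which is Hölder at the complement of `Ω` is globally Hölder with the same
constant. -/
theorem holderBound_of_subsolution {K Ω : Set E} {α β C : ℝ} {f : ℝ → ℝ} {v : E → ℝ}
    (hK : IsCompact K) (hβ : 0 < β) (hβα : β < α) (hα : α < 1) (hC : 0 ≤ C)
    (hf : ∀ s, 0 ≤ s → 0 ≤ f s)
    (hv0 : ∀ x ∈ K, 0 ≤ v x) (hvc : ContinuousOn v K)
    (hsub : ∀ x ∈ Ω, 0 < v x → SubsolutionAt K α f v x)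
    (hbd : ∀ z ∈ K, z ∉ Ω → ∀ x ∈ K, v z ≤ v x + C * ‖z - x‖ ^ β) :
    HolderBound K C β v := by
  intro x hx
  have hc : ContinuousOn (fun y => v y - C * ‖y - x‖ ^ β) K :=
    hvc.sub (continuous_const.mul ((continuous_id.sub continuous_const).norm.rpow_const
      fun _ => Or.inr hβ.le)).continuousOn
  obtain ⟨y, hy, hmax⟩ := hK.exists_isMaxOn ⟨x, hx⟩ hc
  have hmax' : ∀ w ∈ K, v w - C * ‖w - x‖ ^ β ≤ v y - C * ‖y - x‖ ^ β := fun w hw => hmax hw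
  suffices hle : v y - C * ‖y - x‖ ^ β ≤ v x by
    intro w hw
    linarith [hmax' w hw]
  by_contra! hlt
  have hα0 : 0 < α := hβ.trans hβα
  have hyx : y ≠ x := by
    rintro rfl
    simp [Real.zero_rpow hβ.ne'] at hlt
  have hyΩ : y ∈ Ω := by
    by_contra h
    linarith [hbd y hy h x hx]
  set r := ‖y - x‖ with hr
  have hr0 : 0 < r := norm_pos_iff.2 (sub_ne_zero.2 hyx)
  have hCr : 0 ≤ C * r ^ β := by positivity
  have hvy : 0 < v y := by linarith [hv0 x hx]
  have hdiff : ∀ w ∈ K, v w - v y ≤ C * ((r + ‖w - y‖) ^ β - r ^ β) := by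
    intro w hw
    have h1 : ‖w - x‖ ^ β ≤ (r + ‖w - y‖) ^ β := by
      refine Real.rpow_le_rpow (norm_nonneg _) ?_ hβ.le
      have := norm_add_le (w - y) (y - x)
      rw [sub_add_sub_cancel] at this
      linarith
    have := mul_le_mul_of_nonneg_left h1 hC
    linarith [hmax' w hw]
  have hcone : ∀ w ∈ K, v w ≤ v y + C * (r ^ β / r) * ‖w - y‖ := by
    intro w hw
    have := mul_le_mul_of_nonneg_left
      (add_rpow_sub_rpow_le_linear hβ (hβα.trans hα) hr0 (norm_nonneg (w - y))) hC
    linarith [hdiff w hw]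
  have hq : C * r ^ (β - α) < f (v y) - holderQuot α v y x := by
    have h1 : C * r ^ (β - α) < -holderQuot α v y x := by
      rw [holderQuot, norm_sub_rev, ← hr, ← neg_div, Real.rpow_sub hr0, ← mul_div_assoc]
      exact div_lt_div_of_pos_right (by linarith) (by positivity)
    linarith [hf (v y) hvy.le]
  have hq0 : 0 ≤ C * r ^ (β - α) := by positivity
  obtain ⟨z, hz, hzy, hle⟩ := hsub y hyΩ hvy _ hcone x hx hyx.symm (hq0.trans_lt hq)
  have h1 := hq.trans_le hle
  rw [holderQuot, lt_div_iff₀ (norm_sub_rpow_pos hzy α)] at h1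
  have h2 := mul_le_mul_of_nonneg_left
    (add_rpow_sub_rpow_le hβ hβα hα hr0 (norm_nonneg (z - y))) hC
  have h3 : β / α * (C * r ^ (β - α) * ‖z - y‖ ^ α) ≤ 1 * (C * r ^ (β - α) * ‖z - y‖ ^ α) :=
    mul_le_mul_of_nonneg_right ((div_le_one hα0).2 hβα.le) (by positivity)
  linarith [hdiff z hz]

theorem subsolutionAt_barrier {K : Set E} {α β C F c : ℝ} {f : ℝ → ℝ} {x z : E}
    (hβ : 0 < β) (hβα : β < α) (hα : α < 1) (hC : 0 ≤ C) (hz : z ∈ K) (hzx : z ≠ x)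
    (hpos : 0 < c - C * ‖x - z‖ ^ β) (hF : f (c - C * ‖x - z‖ ^ β) ≤ F)
    (hCF : F ≤ C * (1 - β / α) * ‖x - z‖ ^ (β - α)) :
    SubsolutionAt K α f (fun y => max 0 (c - C * ‖y - z‖ ^ β)) x := by
  intro M _ y _ hyx _
  refine ⟨z, hz, hzx, ?_⟩
  have hr0 : 0 < ‖x - z‖ := norm_pos_iff.2 (sub_ne_zero.2 hzx.symm)
  set r := ‖x - z‖ with hr
  have hbx : max 0 (c - C * r ^ β) = c - C * r ^ β := max_eq_right hpos.le
  have hCr : 0 ≤ C * r ^ β := by positivity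
  have h1 : holderQuot α (fun y => max 0 (c - C * ‖y - z‖ ^ β)) x z = C * r ^ (β - α) := by
    simp only [holderQuot]
    rw [norm_sub_rev z x, ← hr, hbx, sub_self, norm_zero, Real.zero_rpow hβ.ne', mul_zero,
      sub_zero, max_eq_right (by linarith), Real.rpow_sub hr0]
    ring
  have h2 : -(C * (β / α) * r ^ (β - α)) ≤
      holderQuot α (fun y => max 0 (c - C * ‖y - z‖ ^ β)) x y := by
    simp only [holderQuot]
    rw [le_div_iff₀ (norm_sub_rpow_pos hyx α), ← hr, hbx]
    have h3 : ‖y - z‖ ^ β ≤ (r + ‖y - x‖) ^ β := by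
      refine Real.rpow_le_rpow (norm_nonneg _) ?_ hβ.le
      have := norm_add_le (y - x) (x - z)
      rw [sub_add_sub_cancel] at this
      linarith
    have h4 := add_rpow_sub_rpow_le hβ hβα hα hr0 (norm_nonneg (y - x))
    have h5 : C * ‖y - z‖ ^ β ≤ C * (r ^ β + β / α * r ^ (β - α) * ‖y - x‖ ^ α) :=
      mul_le_mul_of_nonneg_left (by linarith) hC
    have h6 := le_max_right 0 (c - C * ‖y - z‖ ^ β)
    linarith
  have h7 : f (max 0 (c - C * ‖x - z‖ ^ β)) ≤ F := by rw [← hr, hbx]; exact hF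
  rw [h1]
  simp only [← hr] at h7 ⊢
  linarith

theorem holderBound_barrier {K : Set E} {β C c : ℝ} (hβ : 0 < β) (hβ1 : β < 1) (hC : 0 ≤ C)
    (z : E) : HolderBound K C β (fun y => max 0 (c - C * ‖y - z‖ ^ β)) := by
  intro x _ y _
  have h1 : ‖x - z‖ ^ β ≤ ‖y - z‖ ^ β + ‖y - x‖ ^ β := by
    refine le_trans (Real.rpow_le_rpow (norm_nonneg _) ?_ hβ.le)
      (Real.rpow_add_le_add_rpow (norm_nonneg _) (norm_nonneg _) hβ.le hβ1.le)
    have := norm_add_le (x - y) (y - z)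
    rw [sub_add_sub_cancel, norm_sub_rev x y] at this
    linarith
  have h2 := mul_le_mul_of_nonneg_left h1 hC
  have h3 : 0 ≤ C * ‖y - x‖ ^ β := by positivity
  refine max_le ?_ ?_
  · linarith [le_max_left 0 (c - C * ‖x - z‖ ^ β)]
  · linarith [le_max_right 0 (c - C * ‖x - z‖ ^ β)]

end PointwiseSolutions

section Perron

open Filter Topology

variable {E : Type*} [NormedAddCommGroup E]

theorem tendsto_quot {α : ℝ} {a b : ℕ → ℝ} {x y : ℕ → E} {a₀ b₀ : ℝ} {x₀ y₀ : E}
    (ha : Tendsto a atTop (𝓝 a₀)) (hb : Tendsto b atTop (𝓝 b₀))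
    (hx : Tendsto x atTop (𝓝 x₀)) (hy : Tendsto y atTop (𝓝 y₀)) (hne : y₀ ≠ x₀) :
    Tendsto (fun k => (b k - a k) / ‖y k - x k‖ ^ α) atTop
      (𝓝 ((b₀ - a₀) / ‖y₀ - x₀‖ ^ α)) :=
  (hb.sub ha).div ((hy.sub hx).norm.rpow_const
    (Or.inl (norm_ne_zero_iff.2 (sub_ne_zero.2 hne)))) (norm_sub_rpow_pos hne α).ne'

theorem tendsto_norm_sub_rpow_zero {γ : ℝ} (hγ : 0 < γ) {x y : ℕ → E} {x₀ : E}
    (hx : Tendsto x atTop (𝓝 x₀)) (hy : Tendsto y atTop (𝓝 x₀)) (M : ℝ) :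
    Tendsto (fun k => M * ‖y k - x k‖ ^ γ) atTop (𝓝 0) := by
  have h := ((hy.sub hx).norm.rpow_const (p := γ) (Or.inr hγ.le)).const_mul M
  simpa [Real.zero_rpow hγ.ne'] using h

theorem linear_div_rpow {x y : E} (h : y ≠ x) (M α : ℝ) :
    M * ‖y - x‖ / ‖y - x‖ ^ α = M * ‖y - x‖ ^ (1 - α) := by
  rw [Real.rpow_sub (norm_pos_iff.2 (sub_ne_zero.2 h)), Real.rpow_one, mul_div_assoc]

theorem div_succ_le {δ : ℝ} (hδ : 0 < δ) (k : ℕ) : δ / ((k : ℝ) + 1) ≤ δ :=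
  div_le_self hδ.le (by linarith [k.cast_nonneg (α := ℝ)])

theorem tendsto_div_succ (δ : ℝ) : Tendsto (fun k : ℕ => δ / ((k : ℝ) + 1)) atTop (𝓝 0) :=
  tendsto_const_nhds.div_atTop
    (tendsto_atTop_add_const_right _ _ tendsto_natCast_atTop_atTop)

/-- The subsolution property is stable under pointwise suprema. -/
theorem subsolutionAt_of_isLUB {K Ω : Set E} {α : ℝ} {f : ℝ → ℝ} {S : Set (E → ℝ)} {u : E → ℝ}
    (hK : IsCompact K) (hΩ : IsOpen Ω) (hΩK : Ω ⊆ K) (hα : α < 1)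
    (hf : ContinuousOn f (Ici 0)) (hSc : ∀ v ∈ S, ContinuousOn v K)
    (hSsub : ∀ v ∈ S, ∀ x ∈ Ω, 0 < v x → SubsolutionAt K α f v x)
    (hu : ∀ x ∈ K, IsLUB ((fun v : E → ℝ => v x) '' S) (u x)) (huc : ContinuousOn u K)
    {x : E} (hx : x ∈ Ω) (hux : 0 < u x) : SubsolutionAt K α f u x := by
  intro M hM y hy hyx hq
  obtain ⟨ρ, hρ, hball⟩ := Metric.isOpen_iff.1 hΩ x hx
  have hyx0 : 0 < ‖y - x‖ := norm_pos_iff.2 (sub_ne_zero.2 hyx)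
  obtain ⟨δ, hδ, hδρ, hδu, hδy⟩ : ∃ δ > 0, δ ≤ ρ ∧ δ ≤ u x ∧ δ ≤ ‖y - x‖ :=
    ⟨min ρ (min (u x) ‖y - x‖), by positivity, min_le_left _ _,
      (min_le_right _ _).trans (min_le_left _ _), (min_le_right _ _).trans (min_le_right _ _)⟩
  set ε : ℕ → ℝ := fun k => δ / ((k : ℝ) + 1) with hε
  have hε0 : ∀ k, 0 < ε k := fun k => by positivity
  have hεδ : ∀ k, ε k ≤ δ := div_succ_le hδ
  have hεlim : Tendsto ε atTop (𝓝 0) := tendsto_div_succ δ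
  have hSle : ∀ v ∈ S, ∀ w ∈ K, v w ≤ u w := fun v hv w hw => (hu w hw).1 ⟨v, hv, rfl⟩
  have hv : ∀ k, ∃ v ∈ S, u x - ε k < v x := by
    intro k
    obtain ⟨_, ⟨v, hv, rfl⟩, hlt, _⟩ := (hu x (hΩK hx)).exists_between (sub_lt_self _ (hε0 k))
    exact ⟨v, hv, hlt⟩
  choose v hvS hvx using hv
  have hmax : ∀ k, ∃ w ∈ K, ∀ t ∈ K,
      v k t - (M + 1) * ‖t - x‖ ≤ v k w - (M + 1) * ‖w - x‖ := by
    intro k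
    obtain ⟨w, hw, h⟩ := hK.exists_isMaxOn ⟨x, hΩK hx⟩ ((hSc (v k) (hvS k)).sub
      (continuous_const.mul (continuous_id.sub continuous_const).norm).continuousOn
        (f := v k) (g := fun t => (M + 1) * ‖t - x‖))
    exact ⟨w, hw, fun t ht => h ht⟩
  choose w hwK hw using hmax
  have hwx : ∀ k, ‖w k - x‖ < ε k := by
    intro k
    have h1 := hw k x (hΩK hx)
    simp only [sub_self, norm_zero, mul_zero, sub_zero] at h1
    linarith [hSle _ (hvS k) _ (hwK k), hM _ (hwK k), hvx k]
  have hwlim : Tendsto w atTop (𝓝 x) :=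
    tendsto_iff_norm_sub_tendsto_zero.2
      (squeeze_zero (fun _ => norm_nonneg _) (fun k => (hwx k).le) hεlim)
  have hwΩ : ∀ k, w k ∈ Ω := fun k => hball (by
    rw [Metric.mem_ball, dist_eq_norm]; linarith [hwx k, hεδ k])
  have hyw : ∀ k, y ≠ w k := by
    rintro k rfl
    linarith [hwx k, hεδ k]
  set a : ℕ → ℝ := fun k => v k (w k) with ha
  have hcone : ∀ k, ∀ t ∈ K, v k t ≤ v k (w k) + |M + 1| * ‖t - w k‖ := by
    intro k t ht
    have h1 := hw k t ht
    have h2 : (M + 1) * (‖t - x‖ - ‖w k - x‖) ≤ |M + 1| * ‖t - w k‖ := by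
      refine (le_abs_self _).trans ?_
      rw [abs_mul]
      refine mul_le_mul_of_nonneg_left ?_ (abs_nonneg _)
      simpa using abs_norm_sub_norm_le (t - x) (w k - x)
    linarith
  have hacone : ∀ k, u x - |M + 1| * ε k - ε k ≤ a k := by
    intro k
    have h1 := hcone k x (hΩK hx)
    rw [norm_sub_rev] at h1
    have h2 := mul_le_mul_of_nonneg_left (hwx k).le (abs_nonneg (M + 1))
    simp only [ha]
    linarith [hvx k]
  have hualim : Tendsto (fun k => u (w k)) atTop (𝓝 (u x)) :=
    (huc x (hΩK hx)).tendsto.comp (tendsto_nhdsWithin_iff.2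
      ⟨hwlim, Eventually.of_forall hwK⟩)
  have halim : Tendsto a atTop (𝓝 (u x)) := by
    refine tendsto_of_tendsto_of_tendsto_of_le_of_le ?_ hualim hacone
      (fun k => hSle _ (hvS k) _ (hwK k))
    simpa using (tendsto_const_nhds.sub (hεlim.const_mul |M + 1|)).sub hεlim
  have hapos : ∀ᶠ k in atTop, 0 < a k := halim.eventually (lt_mem_nhds hux)
  have hfa : Tendsto (fun k => f (a k)) atTop (𝓝 (f (u x))) :=
    (hf (u x) hux.le).tendsto.comp (tendsto_nhdsWithin_iff.2
      ⟨halim, hapos.mono fun k h => h.le⟩)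
  set q : ℕ → ℝ := fun k => f (a k) - (u y - a k) / ‖y - w k‖ ^ α with hqdef
  have hqlim : Tendsto q atTop (𝓝 (f (u x) - holderQuot α u x y)) :=
    hfa.sub (tendsto_quot halim tendsto_const_nhds hwlim tendsto_const_nhds hyx)
  have hqpos : ∀ᶠ k in atTop, 0 < q k := hqlim.eventually (lt_mem_nhds hq)
  have hz : ∀ k, ∃ z ∈ K, 0 < a k → 0 < q k →
      z ≠ w k ∧ q k ≤ (v k z - a k) / ‖z - w k‖ ^ α := by
    intro k
    by_cases h : 0 < a k ∧ 0 < q k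
    · have hqk : q k ≤ f (v k (w k)) - holderQuot α (v k) (w k) y := by
        simp only [hqdef, holderQuot, ha]
        have := div_le_div_of_nonneg_right (sub_le_sub_right (hSle _ (hvS k) y hy) (v k (w k)))
          (norm_sub_rpow_pos (hyw k) α).le
        linarith
      obtain ⟨z, hzK, hzne, hz⟩ := hSsub _ (hvS k) _ (hwΩ k) h.1 _ (hcone k) y hy (hyw k)
        (h.2.trans_le hqk)
      exact ⟨z, hzK, fun _ _ => ⟨hzne, hqk.trans hz⟩⟩
    · exact ⟨x, hΩK hx, fun h1 h2 => (h ⟨h1, h2⟩).elim⟩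
  choose z hzK hz using hz
  obtain ⟨z₀, hz₀K, ψ, hψ, hzlim⟩ := hK.tendsto_subseq hzK
  have hψt := hψ.tendsto_atTop
  have hgood := hψt.eventually (hapos.and hqpos)
  have hz₀x : z₀ ≠ x := by
    rintro rfl
    have hle : f (u z₀) - holderQuot α u z₀ y ≤ 0 := by
      refine le_of_tendsto_of_tendsto (hqlim.comp hψt)
        (tendsto_norm_sub_rpow_zero (sub_pos.2 hα) (hwlim.comp hψt) hzlim |M + 1|) ?_
      filter_upwards [hgood] with k hk
      obtain ⟨hne, hle⟩ := hz (ψ k) hk.1 hk.2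
      refine hle.trans ?_
      simp only [Function.comp]
      rw [← linear_div_rpow hne]
      exact div_le_div_of_nonneg_right (by linarith [hcone (ψ k) _ (hzK (ψ k))])
        (norm_sub_rpow_pos hne α).le
    linarith
  refine ⟨z₀, hz₀K, hz₀x, ?_⟩
  have huz : Tendsto (fun k => u (z (ψ k))) atTop (𝓝 (u z₀)) :=
    (huc z₀ hz₀K).tendsto.comp (tendsto_nhdsWithin_iff.2
      ⟨hzlim, Eventually.of_forall fun k => hzK _⟩)
  refine le_of_tendsto_of_tendsto (hqlim.comp hψt)
    (tendsto_quot (halim.comp hψt) huz (hwlim.comp hψt) hzlim hz₀x) ?_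
  filter_upwards [hgood] with k hk
  obtain ⟨hne, hle⟩ := hz (ψ k) hk.1 hk.2
  exact hle.trans (div_le_div_of_nonneg_right
    (sub_le_sub_right (hSle _ (hvS _) _ (hzK _)) _) (norm_sub_rpow_pos hne α).le)

theorem SubsolutionAt.of_le {K : Set E} {α : ℝ} {f : ℝ → ℝ} {u w : E → ℝ} {x : E}
    (h : SubsolutionAt K α f u x) (hle : ∀ y ∈ K, u y ≤ w y) (hx : w x = u x) :
    SubsolutionAt K α f w x := by
  intro M hM y hy hyx hq
  have hquot : ∀ t ∈ K, t ≠ x → holderQuot α u x t ≤ holderQuot α w x t := fun t ht htx =>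
    div_le_div_of_nonneg_right (by linarith [hle t ht]) (norm_sub_rpow_pos htx α).le
  have h1 := hquot y hy hyx
  rw [hx] at hq hM ⊢
  obtain ⟨z, hz, hzx, hz'⟩ := h M (fun t ht => (hle t ht).trans (hM t ht)) y hy hyx (by linarith)
  exact ⟨z, hz, hzx, by linarith [hquot z hz hzx]⟩

/-- A subsolution that cannot be increased inside `Ω` is a supersolution where it is positive. -/
theorem supersolutionAt_of_maximal {K Ω : Set E} {α : ℝ} {f : ℝ → ℝ} {u : E → ℝ}
    (hK : IsCompact K) (hΩ : IsOpen Ω) (hΩK : Ω ⊆ K) (hα : α < 1)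
    (hf : ContinuousOn f (Ici 0)) (huc : ContinuousOn u K)
    (hsub : ∀ x ∈ Ω, 0 < u x → SubsolutionAt K α f u x)
    (hmax : ∀ w : E → ℝ, ContinuousOn w K → (∀ x ∈ K, u x ≤ w x) →
      (∀ x ∈ K, x ∉ Ω → w x = u x) →
      (∀ x ∈ Ω, 0 < w x → SubsolutionAt K α f w x) → ∀ x ∈ K, w x ≤ u x)
    {x : E} (hx : x ∈ Ω) (hux : 0 < u x) : SupersolutionAt K α f u x := by
  intro M hM y hy hyx hq
  by_contra! hz
  obtain ⟨ρ, hρ, hball⟩ := Metric.isOpen_iff.1 hΩ x hx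
  have hyx0 : 0 < ‖y - x‖ := norm_pos_iff.2 (sub_ne_zero.2 hyx)
  obtain ⟨δ, hδ, hδρ, hδy⟩ : ∃ δ > 0, δ ≤ ρ ∧ δ ≤ ‖y - x‖ :=
    ⟨min ρ ‖y - x‖, by positivity, min_le_left _ _, min_le_right _ _⟩
  obtain ⟨N, hN1, hN⟩ : ∃ N : ℝ, 1 ≤ N ∧ ∀ t ∈ K, u x - N * ‖t - x‖ ≤ u t := by
    refine ⟨max M 1, le_max_right _ _, fun t ht => le_trans ?_ (hM t ht)⟩
    have := mul_le_mul_of_nonneg_right (le_max_left M 1) (norm_nonneg (t - x))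
    linarith
  set ε : ℕ → ℝ := fun k => δ / ((k : ℝ) + 1) with hε
  have hε0 : ∀ k, 0 < ε k := fun k => by positivity
  have hεδ : ∀ k, ε k ≤ δ := div_succ_le hδ
  have hεlim : Tendsto ε atTop (𝓝 0) := tendsto_div_succ δ
  set φ : ℕ → E → ℝ := fun k t => u x + ε k - 2 * N * ‖t - x‖ with hφ
  have hφc : ∀ k, Continuous (φ k) := fun k =>
    continuous_const.sub (continuous_const.mul (continuous_id.sub continuous_const).norm)
  have hclose : ∀ k, ∀ t ∈ K, u t < φ k t → N * ‖t - x‖ < ε k := by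
    intro k t ht h
    have := hN t ht
    simp only [hφ] at h
    linarith
  have hclose' : ∀ k, ∀ t ∈ K, u t < φ k t → ‖t - x‖ < ε k := by
    intro k t ht h
    have := hclose k t ht h
    nlinarith [norm_nonneg (t - x)]
  have hφlip : ∀ k s t, φ k s - 2 * N * ‖t - s‖ ≤ φ k t := by
    intro k s t
    have h1 := norm_add_le (t - s) (s - x)
    rw [sub_add_sub_cancel] at h1
    simp only [hφ]
    nlinarith
  set a : ℕ → E → ℝ := fun k t => max (u t) (φ k t) with ha
  have hbad : ∀ k, ∃ w ∈ Ω, ∃ t ∈ K, u w < φ k w ∧ 0 < φ k w ∧ t ≠ w ∧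
      (u y - φ k w) / ‖y - w‖ ^ α < f (φ k w) - (a k t - φ k w) / ‖t - w‖ ^ α := by
    intro k
    by_contra! hno
    have hle := hmax (a k) (huc.sup (hφc k).continuousOn) (fun t _ => le_max_left _ _) ?_ ?_
      x (hΩK hx)
    · have h1 : φ k x ≤ a k x := le_max_right _ _
      simp only [hφ, sub_self, norm_zero, mul_zero, sub_zero] at h1
      linarith [hε0 k]
    · intro t ht htΩ
      refine max_eq_left (not_lt.1 fun h => htΩ (hball ?_))
      rw [Metric.mem_ball, dist_eq_norm]
      linarith [hclose' k t ht h, hεδ k]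
    · intro w hw hpos
      rcases le_or_gt (φ k w) (u w) with h | h
      · have haw : a k w = u w := max_eq_left h
        exact (hsub w hw (haw ▸ hpos)).of_le (fun t _ => le_max_left _ _) haw
      · have haw : a k w = φ k w := max_eq_right h.le
        have hyw : y ≠ w := by
          rintro rfl
          linarith [hclose' k _ hy h, hεδ k]
        intro _ _ t ht htw _
        refine ⟨y, hy, hyw, ?_⟩
        simp only [holderQuot]
        rw [haw]
        refine (hno w hw t ht h (haw ▸ hpos) htw).trans ?_
        exact div_le_div_of_nonneg_right (sub_le_sub_right (le_max_left _ _) _)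
          (norm_sub_rpow_pos hyw α).le
  choose w hwΩ t htK huw hφpos htw hlt using hbad
  have hwx := fun k => hclose k _ (hΩK (hwΩ k)) (huw k)
  have hwlim : Tendsto w atTop (𝓝 x) :=
    tendsto_iff_norm_sub_tendsto_zero.2 (squeeze_zero (fun _ => norm_nonneg _)
      (fun k => (hclose' k _ (hΩK (hwΩ k)) (huw k)).le) hεlim)
  set b : ℕ → ℝ := fun k => φ k (w k) with hb
  have hblim : Tendsto b atTop (𝓝 (u x)) := by
    have h := (tendsto_const_nhds (x := u x)).add hεlim |>.sub
      ((tendsto_iff_norm_sub_tendsto_zero.1 hwlim).const_mul (2 * N))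
    simpa [hb, hφ] using h
  have hfb : Tendsto (fun k => f (b k)) atTop (𝓝 (f (u x))) :=
    (hf (u x) hux.le).tendsto.comp (tendsto_nhdsWithin_iff.2
      ⟨hblim, Eventually.of_forall fun k => (hφpos k).le⟩)
  have hylim : Tendsto (fun k => (u y - b k) / ‖y - w k‖ ^ α) atTop (𝓝 (holderQuot α u x y)) :=
    tendsto_quot hblim tendsto_const_nhds hwlim tendsto_const_nhds hyx
  obtain ⟨t₀, ht₀K, ψ, hψ, htlim⟩ := hK.tendsto_subseq htK
  have hψt := hψ.tendsto_atTop
  by_cases ht₀ : t₀ = x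
  · subst ht₀
    have hle : holderQuot α u t₀ y ≤ f (u t₀) + 0 := by
      refine le_of_tendsto_of_tendsto' (hylim.comp hψt) ((hfb.comp hψt).add
        (tendsto_norm_sub_rpow_zero (sub_pos.2 hα) (hwlim.comp hψt) htlim (2 * N))) fun k => ?_
      refine (hlt (ψ k)).le.trans ?_
      simp only [Function.comp]
      rw [← linear_div_rpow (htw _), sub_eq_add_neg, ← neg_div]
      refine add_le_add_right (div_le_div_of_nonneg_right ?_
        (norm_sub_rpow_pos (htw _) α).le) _
      have h1 : φ (ψ k) (t (ψ k)) ≤ a (ψ k) (t (ψ k)) := le_max_right _ _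
      linarith [hφlip (ψ k) (w (ψ k)) (t (ψ k))]
    linarith
  · have hut : Tendsto (fun k => u (t (ψ k))) atTop (𝓝 (u t₀)) :=
      (huc t₀ ht₀K).tendsto.comp (tendsto_nhdsWithin_iff.2
        ⟨htlim, Eventually.of_forall fun k => htK _⟩)
    have hle : holderQuot α u x y ≤ f (u x) - holderQuot α u x t₀ := by
      refine le_of_tendsto_of_tendsto' (hylim.comp hψt) ((hfb.comp hψt).sub
        (tendsto_quot (hblim.comp hψt) hut (hwlim.comp hψt) htlim ht₀)) fun k => ?_
      refine (hlt (ψ k)).le.trans (sub_le_sub_left (div_le_div_of_nonneg_right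
        (sub_le_sub_right (le_max_left _ _) _) (norm_sub_rpow_pos (htw _) α).le) _)
    linarith [hz t₀ ht₀K ht₀]

end Perron

section Viscosity

open Filter Topology

variable {n : ℕ}

theorem exists_abs_sub_le_mul_norm {E : Type*} [NormedAddCommGroup E] [NormedSpace ℝ E]
    {K : Set E} (hK : IsCompact K) {φ : E → ℝ} (hφ : ContinuousOn φ K) {x : E} (hx : x ∈ K)
    (hd : DifferentiableAt ℝ φ x) : ∃ M : ℝ, 0 ≤ M ∧ ∀ y ∈ K, |φ y - φ x| ≤ M * ‖y - x‖ := by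
  obtain ⟨c, hc⟩ := hd.isBigO_sub.bound
  obtain ⟨r, hr, hball⟩ := Metric.eventually_nhds_iff.1 hc
  obtain ⟨B, hB⟩ := hK.exists_bound_of_continuousOn hφ
  have hB0 : 0 ≤ B := (norm_nonneg _).trans (hB x hx)
  refine ⟨max c (2 * B / r), le_max_of_le_right (by positivity), fun y hy => ?_⟩
  rcases lt_or_ge ‖y - x‖ r with h | h
  · exact (hball (by rwa [dist_eq_norm])).trans
      (mul_le_mul_of_nonneg_right (le_max_left _ _) (norm_nonneg _))
  · calc |φ y - φ x| ≤ |φ y| + |φ x| := abs_sub _ _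
      _ ≤ 2 * B := by
        have h1 := hB y hy
        have h2 := hB x hx
        rw [Real.norm_eq_abs] at h1 h2
        linarith
      _ = 2 * B / r * r := by field_simp
      _ ≤ 2 * B / r * ‖y - x‖ := mul_le_mul_of_nonneg_left h (by positivity)
      _ ≤ _ := mul_le_mul_of_nonneg_right (le_max_right _ _) (norm_nonneg _)

theorem abs_holderQuot_le {E : Type*} [NormedAddCommGroup E] {φ : E → ℝ} {x y : E} {M α : ℝ}
    (hyx : y ≠ x) (h : |φ y - φ x| ≤ M * ‖y - x‖) :
    |holderQuot α φ x y| ≤ M * ‖y - x‖ ^ (1 - α) := by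
  have hp := norm_sub_rpow_pos hyx α
  rw [holderQuot, abs_div, abs_of_pos hp, ← linear_div_rpow hyx]
  exact div_le_div_of_nonneg_right h hp.le

section Bounds

variable {Ω : Set (EuclideanSpace ℝ (Fin n))} {φ : EuclideanSpace ℝ (Fin n) → ℝ}
  {x : EuclideanSpace ℝ (Fin n)} {M α : ℝ}

theorem exists_abs_holderQuot_le (hΩb : Bornology.IsBounded Ω) (hα : α < 1) (hM : 0 ≤ M)
    (hx : x ∈ closure Ω) (h : ∀ y ∈ closure Ω, |φ y - φ x| ≤ M * ‖y - x‖) :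
    ∃ B : ℝ, ∀ y ∈ closure Ω \ {x}, |holderQuot α φ x y| ≤ B := by
  refine ⟨M * diam (closure Ω) ^ (1 - α), fun y hy => (abs_holderQuot_le hy.2 (h y hy.1)).trans ?_⟩
  refine mul_le_mul_of_nonneg_left (Real.rpow_le_rpow (norm_nonneg _) ?_ (by linarith)) hM
  rw [← dist_eq_norm]
  exact dist_le_diam_of_mem hΩb.closure hy.1 hx

theorem tendsto_holderQuot_zero (hΩo : IsOpen Ω) (hα : α < 1)
    (hx : x ∈ Ω) (h : ∀ y ∈ closure Ω, |φ y - φ x| ≤ M * ‖y - x‖) :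
    Tendsto (holderQuot α φ x) (𝓝[≠] x) (𝓝 0) := by
  have hc : Continuous fun y : EuclideanSpace ℝ (Fin n) => M * ‖y - x‖ ^ (1 - α) :=
    continuous_const.mul ((continuous_id.sub continuous_const).norm.rpow_const
      fun _ => Or.inr (by linarith))
  have ht := (hc.tendsto x).mono_left (nhdsWithin_le_nhds (s := {x}ᶜ))
  simp only [sub_self, norm_zero, Real.zero_rpow (sub_ne_zero.2 hα.ne'), mul_zero] at ht
  refine squeeze_zero_norm' ?_ ht
  filter_upwards [self_mem_nhdsWithin, mem_nhdsWithin_of_mem_nhds (hΩo.mem_nhds hx)]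
    with y hy hyΩ
  exact abs_holderQuot_le hy (h y (subset_closure hyΩ))

theorem holderQuot_le_Lplus (hΩb : Bornology.IsBounded Ω) (hα : α < 1) (hM : 0 ≤ M)
    (hx : x ∈ closure Ω) (h : ∀ y ∈ closure Ω, |φ y - φ x| ≤ M * ‖y - x‖)
    {y : EuclideanSpace ℝ (Fin n)} (hy : y ∈ closure Ω) (hyx : y ≠ x) :
    holderQuot α φ x y ≤ Lplus Ω α φ x := by
  obtain ⟨B, hB⟩ := exists_abs_holderQuot_le hΩb hα hM hx h
  refine le_csSup ⟨B, ?_⟩ ⟨y, ⟨hy, hyx⟩, rfl⟩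
  rintro _ ⟨z, hz, rfl⟩
  exact (abs_le.1 (hB z hz)).2

theorem Lminus_le_holderQuot (hΩb : Bornology.IsBounded Ω) (hα : α < 1) (hM : 0 ≤ M)
    (hx : x ∈ closure Ω) (h : ∀ y ∈ closure Ω, |φ y - φ x| ≤ M * ‖y - x‖)
    {y : EuclideanSpace ℝ (Fin n)} (hy : y ∈ closure Ω) (hyx : y ≠ x) :
    Lminus Ω α φ x ≤ holderQuot α φ x y := by
  obtain ⟨B, hB⟩ := exists_abs_holderQuot_le hΩb hα hM hx h
  refine csInf_le ⟨-B, ?_⟩ ⟨y, ⟨hy, hyx⟩, rfl⟩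
  rintro _ ⟨z, hz, rfl⟩
  exact (abs_le.1 (hB z hz)).1

variable [Nontrivial (EuclideanSpace ℝ (Fin n))]

theorem closure_diff_singleton_nonempty (hΩo : IsOpen Ω) (hx : x ∈ Ω) :
    (closure Ω \ {x}).Nonempty := by
  have : (𝓝[≠] x).NeBot := Module.punctured_nhds_neBot ℝ _ x
  obtain ⟨y, hy, hyΩ⟩ := Filter.nonempty_of_mem (inter_mem
    (self_mem_nhdsWithin (a := x) (s := {x}ᶜ))
    (mem_nhdsWithin_of_mem_nhds (hΩo.mem_nhds hx)))
  exact ⟨y, subset_closure hyΩ, hy⟩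

theorem Lplus_nonneg (hΩo : IsOpen Ω) (hΩb : Bornology.IsBounded Ω) (hα : α < 1) (hM : 0 ≤ M)
    (hx : x ∈ Ω) (h : ∀ y ∈ closure Ω, |φ y - φ x| ≤ M * ‖y - x‖) :
    0 ≤ Lplus Ω α φ x := by
  have : (𝓝[≠] x).NeBot := Module.punctured_nhds_neBot ℝ _ x
  refine le_of_tendsto (tendsto_holderQuot_zero hΩo hα hx h) ?_
  filter_upwards [self_mem_nhdsWithin, mem_nhdsWithin_of_mem_nhds (hΩo.mem_nhds hx)]
    with y hy hyΩ
  exact holderQuot_le_Lplus hΩb hα hM (subset_closure hx) h (subset_closure hyΩ) hy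

theorem Lminus_nonpos (hΩo : IsOpen Ω) (hΩb : Bornology.IsBounded Ω) (hα : α < 1) (hM : 0 ≤ M)
    (hx : x ∈ Ω) (h : ∀ y ∈ closure Ω, |φ y - φ x| ≤ M * ‖y - x‖) :
    Lminus Ω α φ x ≤ 0 := by
  have : (𝓝[≠] x).NeBot := Module.punctured_nhds_neBot ℝ _ x
  refine ge_of_tendsto (tendsto_holderQuot_zero hΩo hα hx h) ?_
  filter_upwards [self_mem_nhdsWithin, mem_nhdsWithin_of_mem_nhds (hΩo.mem_nhds hx)]
    with y hy hyΩ
  exact Lminus_le_holderQuot hΩb hα hM (subset_closure hx) h (subset_closure hyΩ) hy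

end Bounds

variable [Nontrivial (EuclideanSpace ℝ (Fin n))] {Ω U : Set (EuclideanSpace ℝ (Fin n))}
  {u : EuclideanSpace ℝ (Fin n) → ℝ} {α : ℝ} {f : ℝ → ℝ}

theorem isViscositySubsolution_of_forall_subsolutionAt (hΩo : IsOpen Ω)
    (hΩb : Bornology.IsBounded Ω) (hα : α < 1) (hU : IsOpen U) (hUΩ : U ⊆ Ω)
    (huc : ContinuousOn u (closure Ω))
    (h : ∀ x ∈ U, SubsolutionAt (closure Ω) α f u x) : IsViscositySubsolution Ω U α f u := by
  refine ⟨huc.upperSemicontinuousOn, fun φ hφ hφc hle x hx hux => ?_⟩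
  have hxΩ := hUΩ hx
  have hxK := subset_closure hxΩ
  have hd := (hφ.contDiffAt (hU.mem_nhds hx)).differentiableAt one_ne_zero
  obtain ⟨M, hM, hMφ⟩ := exists_abs_sub_le_mul_norm hΩb.isCompact_closure hφc hxK hd
  have hquot : ∀ y ∈ closure Ω, y ≠ x → holderQuot α u x y ≤ holderQuot α φ x y :=
    fun y hy hyx => div_le_div_of_nonneg_right (by linarith [hle y hy])
      (norm_sub_rpow_pos hyx α).le
  suffices hs : f (φ x) - Lplus Ω α φ x ≤ Lminus Ω α φ x by
    rw [Lop]; linarith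
  refine le_csInf ((closure_diff_singleton_nonempty hΩo hxΩ).image _) ?_
  rintro _ ⟨y, ⟨hy, hyx⟩, rfl⟩
  change _ ≤ holderQuot α φ x y
  have hy1 := hquot y hy hyx
  rw [← hux]
  rcases le_or_gt (f (u x) - holderQuot α u x y) 0 with hq | hq
  · linarith [Lplus_nonneg hΩo hΩb hα hM hxΩ hMφ]
  · obtain ⟨z, hz, hzx, hzq⟩ := h x hx M (fun t ht => by
      linarith [hle t ht, (abs_le.1 (hMφ t ht)).2]) y hy hyx hq
    linarith [hquot z hz hzx, holderQuot_le_Lplus hΩb hα hM hxK hMφ hz hzx]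

theorem isViscositySupersolution_of_forall_supersolutionAt (hΩo : IsOpen Ω)
    (hΩb : Bornology.IsBounded Ω) (hα : α < 1) (hU : IsOpen U) (hUΩ : U ⊆ Ω)
    (huc : ContinuousOn u (closure Ω))
    (h : ∀ x ∈ U, SupersolutionAt (closure Ω) α f u x) :
    IsViscositySupersolution Ω U α f u := by
  refine ⟨huc.lowerSemicontinuousOn, fun φ hφ hφc hle x hx hux => ?_⟩
  have hxΩ := hUΩ hx
  have hxK := subset_closure hxΩ
  have hd := (hφ.contDiffAt (hU.mem_nhds hx)).differentiableAt one_ne_zero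
  obtain ⟨M, hM, hMφ⟩ := exists_abs_sub_le_mul_norm hΩb.isCompact_closure hφc hxK hd
  have hquot : ∀ y ∈ closure Ω, y ≠ x → holderQuot α φ x y ≤ holderQuot α u x y :=
    fun y hy hyx => div_le_div_of_nonneg_right (by linarith [hle y hy])
      (norm_sub_rpow_pos hyx α).le
  suffices hs : Lplus Ω α φ x ≤ f (φ x) - Lminus Ω α φ x by
    rw [Lop]; linarith
  refine csSup_le ((closure_diff_singleton_nonempty hΩo hxΩ).image _) ?_
  rintro _ ⟨y, ⟨hy, hyx⟩, rfl⟩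
  change holderQuot α φ x y ≤ _
  have hy1 := hquot y hy hyx
  rw [← hux]
  rcases le_or_gt 0 (f (u x) - holderQuot α u x y) with hq | hq
  · linarith [Lminus_nonpos hΩo hΩb hα hM hxΩ hMφ]
  · obtain ⟨z, hz, hzx, hzq⟩ := h x hx M (fun t ht => by
      linarith [hle t ht, (abs_le.1 (hMφ t ht)).1]) y hy hyx hq
    linarith [hquot z hz hzx, Lminus_le_holderQuot hΩb hα hM hxK hMφ hz hzx]

end Viscosity

/-- Perron's method: existence of a Hölder solution, in the pointwise sense, of the obstacle
problem with boundary values `g` on `K \ Ω`. -/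
theorem exists_pointwise_solution {E : Type*} [NormedAddCommGroup E] {K Ω : Set E}
    {α β : ℝ} {f : ℝ → ℝ} {g : E → ℝ} (hK : IsCompact K) (hΩo : IsOpen Ω) (hΩK : Ω ⊆ K)
    (hne : (K \ Ω).Nonempty) (hβ0 : 0 < β) (hβα : β < α) (hα1 : α < 1)
    (hfc : ContinuousOn f (Ici 0)) (hfm : MonotoneOn f (Ici 0)) (hfpos : ∀ s, 0 ≤ s → 0 ≤ f s)
    (hgpos : ∀ x ∈ K \ Ω, 0 ≤ g x)
    (hg : ∃ A : ℝ, ∀ x ∈ K \ Ω, ∀ y ∈ K \ Ω, |g x - g y| ≤ A * ‖x - y‖ ^ β) :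
    ∃ (C : ℝ) (u : E → ℝ), (∀ x ∈ K, 0 ≤ u x) ∧ HolderBound K C β u ∧
      (∀ x ∈ K \ Ω, u x = g x) ∧
      (∀ x ∈ Ω, 0 < u x → SubsolutionAt K α f u x) ∧
      (∀ x ∈ Ω, 0 < u x → SupersolutionAt K α f u x) := by
  obtain ⟨A, hA⟩ := hg
  obtain ⟨z₀, hz₀⟩ := hne
  have hα0 : 0 < α := hβ0.trans hβα
  obtain ⟨D, hD0, hD⟩ : ∃ D : ℝ, 0 < D ∧ ∀ x ∈ K, ∀ y ∈ K, ‖x - y‖ ≤ D :=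
    ⟨diam K + 1, by linarith [diam_nonneg (s := K)], fun x hx y hy => by
      rw [← dist_eq_norm]; linarith [dist_le_diam_of_mem hK.isBounded hx hy]⟩
  set G := g z₀ + |A| * D ^ β with hG
  have hgG : ∀ z ∈ K \ Ω, g z ≤ G := by
    intro z hz
    have h1 := (abs_le.1 (hA z hz z₀ hz₀)).2
    have h2 : A * ‖z - z₀‖ ^ β ≤ |A| * D ^ β :=
      mul_le_mul (le_abs_self A) (Real.rpow_le_rpow (norm_nonneg _) (hD z hz.1 z₀ hz₀.1) hβ0.le)
        (by positivity) (abs_nonneg A)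
    linarith
  have hG0 : 0 ≤ G := (hgpos z₀ hz₀).trans (hgG z₀ hz₀)
  have hγ : 0 < 1 - β / α := sub_pos.2 ((div_lt_one hα0).2 hβα)
  obtain ⟨C, hC0, hCA, hCF⟩ : ∃ C : ℝ, 0 ≤ C ∧ A ≤ C ∧
      f G ≤ C * (1 - β / α) * D ^ (β - α) := by
    refine ⟨max |A| (f G / ((1 - β / α) * D ^ (β - α))), le_max_of_le_left (abs_nonneg A),
      (le_abs_self A).trans (le_max_left _ _), ?_⟩
    rw [mul_assoc, ← div_le_iff₀ (by positivity)]
    exact le_max_right _ _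
  set S : Set (E → ℝ) := {v | (∀ x ∈ K, 0 ≤ v x) ∧ HolderBound K C β v ∧
    (∀ x ∈ K \ Ω, v x ≤ g x) ∧ ∀ x ∈ Ω, 0 < v x → SubsolutionAt K α f v x} with hS
  have hbar : ∀ z ∈ K \ Ω, (fun y => max 0 (g z - C * ‖y - z‖ ^ β)) ∈ S := by
    intro z hz
    refine ⟨fun x _ => le_max_left _ _, holderBound_barrier hβ0 (hβα.trans hα1) hC0 z,
      fun x hx => max_le (hgpos x hx) ?_, fun x hx hpos => ?_⟩
    · have h1 := (abs_le.1 (hA x hx z hz)).1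
      have h2 := mul_le_mul_of_nonneg_right hCA
        (Real.rpow_nonneg (norm_nonneg (x - z)) β)
      linarith
    · have hpos' : 0 < g z - C * ‖x - z‖ ^ β := by simpa using hpos
      have hzx : z ≠ x := by rintro rfl; exact hz.2 hx
      have hr : 0 < ‖x - z‖ := norm_pos_iff.2 (sub_ne_zero.2 hzx.symm)
      refine subsolutionAt_barrier (F := f G) hβ0 hβα hα1 hC0 hz.1 hzx hpos'
        (hfm hpos'.le hG0 ?_) (hCF.trans (mul_le_mul_of_nonneg_left ?_ (by positivity)))
      · have : 0 ≤ C * ‖x - z‖ ^ β := by positivity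
        linarith [hgG z hz]
      · exact Real.rpow_le_rpow_of_nonpos hr (hD x (hΩK hx) z hz.1) (by linarith)
  have hSne : S.Nonempty := ⟨_, hbar z₀ hz₀⟩
  have hSbdd : ∀ x ∈ K, BddAbove ((fun v : E → ℝ => v x) '' S) := by
    rintro x hx
    refine ⟨g z₀ + C * ‖x - z₀‖ ^ β, ?_⟩
    rintro _ ⟨v, hv, rfl⟩
    exact (hv.2.1 z₀ hz₀.1 x hx).trans (by linarith [hv.2.2.1 z₀ hz₀])
  set u : E → ℝ := fun x => sSup ((fun v : E → ℝ => v x) '' S) with hu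
  have hlub : ∀ x ∈ K, IsLUB ((fun v : E → ℝ => v x) '' S) (u x) := fun x hx =>
    isLUB_csSup (hSne.image _) (hSbdd x hx)
  have hle : ∀ v ∈ S, ∀ x ∈ K, v x ≤ u x := fun v hv x hx => (hlub x hx).1 ⟨v, hv, rfl⟩
  have hu0 : ∀ x ∈ K, 0 ≤ u x := fun x hx =>
    (le_max_left _ _).trans (hle _ (hbar z₀ hz₀) x hx)
  have huH : HolderBound K C β u := by
    intro x hx y hy
    refine (hlub y hy).2 ?_
    rintro _ ⟨v, hv, rfl⟩
    exact (hv.2.1 x hx y hy).trans (by linarith [hle v hv x hx])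
  have hug : ∀ x ∈ K \ Ω, u x = g x := by
    intro x hx
    refine le_antisymm ((hlub x hx.1).2 ?_) ?_
    · rintro _ ⟨v, hv, rfl⟩
      exact hv.2.2.1 x hx
    · refine le_trans (le_of_eq ?_) (hle _ (hbar x hx) x hx.1)
      simp [Real.zero_rpow hβ0.ne', hgpos x hx]
  have huc := huH.continuousOn hβ0
  have husub : ∀ x ∈ Ω, 0 < u x → SubsolutionAt K α f u x := fun x hx hpos =>
    subsolutionAt_of_isLUB hK hΩo hΩK hα1 hfc (fun v hv => hv.2.1.continuousOn hβ0)
      (fun v hv => hv.2.2.2) hlub huc hx hpos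
  refine ⟨C, u, hu0, huH, hug, husub, fun x hx hpos =>
    supersolutionAt_of_maximal hK hΩo hΩK hα1 hfc huc husub ?_ hx hpos⟩
  intro w hwc huw hwu hwsub
  have hw0 : ∀ x ∈ K, 0 ≤ w x := fun x hx => (hu0 x hx).trans (huw x hx)
  refine hle w ⟨hw0, ?_, fun x hx => ((hwu x hx.1 hx.2).trans (hug x hx)).le, hwsub⟩
  refine holderBound_of_subsolution hK hβ0 hβα hα1 hC0 hfpos hw0 hwc hwsub ?_
  intro z hz hzΩ x hx
  rw [hwu z hz hzΩ]
  linarith [huH x hx z hz, huw x hx]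

/-- Obstacle problem (Theorem 1.2): for `f` continuous, non-decreasing and
nonnegative on `[0,∞)` and `0 ≤ g ∈ C^{0,β}(∂Ω)` with `0 < β < α < 1`, there
is a nonnegative `u ∈ C^{0,β}(Ω̄)` with `u = g` on `∂Ω` which is a viscosity
solution of `L[u] = f(u)` on the positivity set `{x ∈ Ω : u(x) > 0}`. -/
theorem stmt_17 (n : ℕ) (hn : 1 ≤ n) (Ω : Set (EuclideanSpace ℝ (Fin n)))
    (hΩo : IsOpen Ω) (hΩne : Ω.Nonempty) (hΩb : Bornology.IsBounded Ω)
    (α β : ℝ) (hβ0 : 0 < β) (hβα : β < α) (hα1 : α < 1)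
    (f : ℝ → ℝ) (hfc : ContinuousOn f (Set.Ici 0))
    (hfm : MonotoneOn f (Set.Ici 0)) (hfpos : ∀ s : ℝ, 0 ≤ s → 0 ≤ f s)
    (g : EuclideanSpace ℝ (Fin n) → ℝ) (hgpos : ∀ x ∈ frontier Ω, 0 ≤ g x)
    (hg : ∃ K : ℝ, ∀ x ∈ frontier Ω, ∀ y ∈ frontier Ω,
      |g x - g y| ≤ K * ‖x - y‖ ^ β) :
    ∃ u : EuclideanSpace ℝ (Fin n) → ℝ,
      (∀ x ∈ closure Ω, 0 ≤ u x) ∧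
      ContinuousOn u (closure Ω) ∧
      (∃ K : ℝ, ∀ x ∈ closure Ω, ∀ y ∈ closure Ω,
        |u x - u y| ≤ K * ‖x - y‖ ^ β) ∧
      (∀ x ∈ frontier Ω, u x = g x) ∧
      IsViscositySubsolution Ω {x ∈ Ω | 0 < u x} α f u ∧
      IsViscositySupersolution Ω {x ∈ Ω | 0 < u x} α f u := by
  have : Nonempty (Fin n) := ⟨⟨0, hn⟩⟩
  have hfr : frontier Ω = closure Ω \ Ω := hΩo.frontier_eq
  have hne : (closure Ω \ Ω).Nonempty := by
    rw [← hfr, nonempty_iff_ne_empty]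
    intro h
    rcases frontier_eq_empty_iff.1 h with h | h
    · exact hΩne.ne_empty h
    · exact NormedSpace.unbounded_univ ℝ (EuclideanSpace ℝ (Fin n)) (h ▸ hΩb)
  rw [hfr] at hgpos hg ⊢
  obtain ⟨C, u, hu0, huH, hug, hsub, hsuper⟩ := exists_pointwise_solution
    hΩb.isCompact_closure hΩo subset_closure hne hβ0 hβα hα1 hfc hfm hfpos hgpos hg
  have huc := huH.continuousOn hβ0
  have hU : IsOpen {x ∈ Ω | 0 < u x} :=
    (huc.mono subset_closure).isOpen_inter_preimage hΩo isOpen_Ioi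
  exact ⟨u, hu0, huc, ⟨C, fun x hx y hy => huH.abs_sub_le hx hy⟩, hug,
    isViscositySubsolution_of_forall_subsolutionAt hΩo hΩb hα1 hU (fun x hx => hx.1) huc
      fun x hx => hsub x hx.1 hx.2,
    isViscositySupersolution_of_forall_supersolutionAt hΩo hΩb hα1 hU (fun x hx => hx.1) huc
      fun x hx => hsuper x hx.1 hx.2⟩
end

section
/- Let α ∈ (0,1] and let f : ℝ → ℝ satisfy f(s) = 0 for all s ≤ 0. If u : Ω̄ → ℝ is a continuous viscosity subsolution of L[u] = f(u) on Ω, then the function x ↦ max(u(x), 0) is also a viscosity subsolution of L[u] = f(u) on Ω. -/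
open Set Metric

/-- At a global minimum point over `closure Ω`, the operator `L` is nonnegative. -/
theorem Lop_nonneg_of_isMinOn {n : ℕ} {Ω : Set (EuclideanSpace ℝ (Fin n))} {α : ℝ}
    {u : EuclideanSpace ℝ (Fin n) → ℝ} {x : EuclideanSpace ℝ (Fin n)}
    (h : IsMinOn u (closure Ω) x) : 0 ≤ Lop Ω α u x := by
  have hq : ∀ r ∈ (fun y => (u y - u x) / ‖y - x‖ ^ α) '' (closure Ω \ {x}), 0 ≤ r := by
    rintro _ ⟨y, hy, rfl⟩
    exact div_nonneg (sub_nonneg.2 (h hy.1)) (by positivity)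
  exact add_nonneg (Real.sSup_nonneg hq) (Real.sInf_nonneg hq)

/-- If `f` vanishes on `(−∞, 0]` and `u` is a continuous viscosity subsolution
of `L[u] = f(u)` on `Ω`, then `max(u, 0)` is also a viscosity subsolution. -/
theorem stmt_18 (n : ℕ) (hn : 1 ≤ n) (Ω : Set (EuclideanSpace ℝ (Fin n)))
    (hΩo : IsOpen Ω) (hΩne : Ω.Nonempty) (hΩb : Bornology.IsBounded Ω)
    (α : ℝ) (hα0 : 0 < α) (hα1 : α ≤ 1)
    (f : ℝ → ℝ) (hf : ∀ s : ℝ, s ≤ 0 → f s = 0)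
    (u : EuclideanSpace ℝ (Fin n) → ℝ) (huc : ContinuousOn u (closure Ω))
    (hu : IsViscositySubsolution Ω Ω α f u) :
    IsViscositySubsolution Ω Ω α f (fun x => max (u x) 0) := by
  refine ⟨(ContinuousOn.sup huc continuousOn_const).upperSemicontinuousOn, ?_⟩
  intro φ hφ hφc hle x₀ hx₀ hx₀eq
  rcases le_total 0 (u x₀) with h | h
  · exact hu.2 φ hφ hφc (fun x hx => (le_max_left _ _).trans (hle x hx)) x₀ hx₀
      ((max_eq_left h).symm.trans hx₀eq)
  · have hφ₀ : φ x₀ = 0 := hx₀eq.symm.trans (max_eq_right h)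
    have hL := Lop_nonneg_of_isMinOn (α := α) (u := φ) (x := x₀) (Ω := Ω) fun y hy =>
      hφ₀.trans_le ((le_max_right _ _).trans (hle y hy))
    rw [hf _ hφ₀.le]
    linarith
end

section
/- Let α ∈ (0,1] and let f : ℝ → ℝ satisfy f(s) = 0 for all s ≤ 0. Let u : Ω̄ → ℝ be continuous, nonnegative on Ω̄, and a viscosity solution of L[u] = f(u) on Ω. If u is not identically zero on Ω̄, then u(x) > 0 for every x ∈ Ω. -/
open Set Metric

/-- Strong positivity: if `f` vanishes on `(−∞, 0]` and `u` is a continuous,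
nonnegative viscosity solution of `L[u] = f(u)` on `Ω` that is not identically
zero on `Ω̄`, then `u > 0` everywhere in `Ω`. -/
theorem stmt_19 (n : ℕ) (hn : 1 ≤ n) (Ω : Set (EuclideanSpace ℝ (Fin n)))
    (hΩo : IsOpen Ω) (hΩne : Ω.Nonempty) (hΩb : Bornology.IsBounded Ω)
    (α : ℝ) (hα0 : 0 < α) (hα1 : α ≤ 1)
    (f : ℝ → ℝ) (hf : ∀ s : ℝ, s ≤ 0 → f s = 0)
    (u : EuclideanSpace ℝ (Fin n) → ℝ) (huc : ContinuousOn u (closure Ω))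
    (hupos : ∀ x ∈ closure Ω, 0 ≤ u x)
    (husub : IsViscositySubsolution Ω Ω α f u)
    (husup : IsViscositySupersolution Ω Ω α f u)
    (hunz : ¬ ∀ x ∈ closure Ω, u x = 0) :
    ∀ x ∈ Ω, 0 < u x := by
  intro x₀ hx₀
  have hx₀c : x₀ ∈ closure Ω := subset_closure hx₀
  refine lt_of_le_of_ne (hupos x₀ hx₀c) fun hux₀ => ?_
  push Not at hunz
  obtain ⟨y, hy, huy⟩ := hunz
  have huy0 : 0 < u y := lt_of_le_of_ne (hupos y hy) huy.symm
  obtain ⟨r, hr, hball⟩ := Metric.continuousOn_iff.1 huc y hy (u y / 2) (half_pos huy0)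
  have hlow : ∀ z ∈ closure Ω, dist z y < r → u y / 2 < u z := fun z hz hzy => by
    have h := hball z hz hzy
    rw [Real.dist_eq, abs_lt] at h
    linarith [h.1]
  have hx₀y : r ≤ dist x₀ y := by
    by_contra! h
    linarith [hlow x₀ hx₀c h]
  -- The test function is a small smooth bump at `y`, vanishing near `x₀`.
  let b : ContDiffBump y := ⟨r / 4, r / 2, by positivity, by linarith⟩
  set φ : EuclideanSpace ℝ (Fin n) → ℝ := fun z => u y / 2 * b z with hφ
  have hφ_diff : ContDiff ℝ 1 φ := contDiff_const.mul b.contDiff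
  have hφ_nonneg : ∀ z, 0 ≤ φ z := fun z => mul_nonneg (half_pos huy0).le b.nonneg
  have hφ_le : ∀ z, φ z ≤ u y / 2 := fun z =>
    mul_le_of_le_one_right (half_pos huy0).le b.le_one
  have hφ_zero : ∀ z, r / 2 ≤ dist z y → φ z = 0 := fun z hz => by
    simp only [hφ, b.zero_of_le_dist hz, mul_zero]
  have hφx₀ : φ x₀ = 0 := hφ_zero x₀ (by linarith)
  have hφy : φ y = u y / 2 := by
    have : b y = 1 := b.one_of_mem_closedBall (mem_closedBall_self b.rIn_pos.le)
    simp only [hφ, this, mul_one]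
  have hφu : ∀ z ∈ closure Ω, φ z ≤ u z := fun z hz => by
    rcases lt_or_ge (dist z y) (r / 2) with h | h
    · exact (hφ_le z).trans (hlow z hz (by linarith)).le
    · rw [hφ_zero z h]
      exact hupos z hz
  have hsuper := husup.2 φ hφ_diff.contDiffOn hφ_diff.continuous.continuousOn hφu x₀ hx₀
    (by rw [hφx₀, hux₀])
  rw [hφx₀, hf 0 le_rfl, add_zero] at hsuper
  have hminus : 0 ≤ Lminus Ω α φ x₀ := by
    refine Real.sInf_nonneg ?_
    rintro _ ⟨z, -, rfl⟩
    simp only [hφx₀, sub_zero]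
    exact div_nonneg (hφ_nonneg z) (Real.rpow_nonneg (norm_nonneg _) _)
  have hyx₀ : y ≠ x₀ := by
    rintro rfl
    exact huy hux₀.symm
  have hbdd : BddAbove ((fun z => (φ z - φ x₀) / ‖z - x₀‖ ^ α) '' (closure Ω \ {x₀})) := by
    refine ⟨u y / 2 / (r / 2) ^ α, ?_⟩
    rintro _ ⟨z, -, rfl⟩
    simp only [hφx₀, sub_zero]
    rcases lt_or_ge (dist z y) (r / 2) with h | h
    · have hz : r / 2 ≤ ‖z - x₀‖ := by
        rw [← dist_eq_norm, dist_comm]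
        linarith [dist_triangle x₀ z y]
      have := hφ_le z
      gcongr
    · rw [hφ_zero z h, zero_div]
      positivity
  have hplus : 0 < Lplus Ω α φ x₀ := by
    refine lt_of_lt_of_le ?_ (le_csSup hbdd ⟨y, ⟨hy, hyx₀⟩, rfl⟩)
    simp only [hφx₀, hφy, sub_zero]
    have : 0 < ‖y - x₀‖ := norm_pos_iff.2 (sub_ne_zero.2 hyx₀)
    positivity
  rw [Lop] at hsuper
  linarith
end
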